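/- In the transfinite construction over a full model N: if t ⇝_α ρ₁ and t ⇝_α ρ₂ where ρ₁ and ρ₂ are canonical terms with the same canonical type, then ρ₁ ≡ ρ₂. -/

import Mathlib

/-! Infrastructure: the transfinite model construction over a full model of
classical higher-order logic, following Czajka, "A semantic approach to illative
combinatory logic", Section 4. -/

namespace ILM

/-- Type-free λ-terms over a set `C` of primitive constants (de Bruijn representation). -/
inductive Tm (C : Type) : Type
  | var : Nat → Tm C
  | const : C → Tm C
  | app : Tm C → Tm C → Tm C
  | lam : Tm C → Tm C

namespace Tm

variable {C : Type}

/-- Renaming of free de Bruijn variables. -/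
def rename (f : Nat → Nat) : Tm C → Tm C
  | .var n => .var (f n)
  | .const c => .const c
  | .app a b => .app (a.rename f) (b.rename f)
  | .lam a => .lam (a.rename fun n => match n with | 0 => 0 | m + 1 => f m + 1)

/-- Shift all free variables up by one. -/
def lift (t : Tm C) : Tm C := t.rename (· + 1)

/-- Simultaneous substitution. -/
def bind (σ : Nat → Tm C) : Tm C → Tm C
  | .var n => σ n
  | .const c => .const c
  | .app a b => .app (a.bind σ) (b.bind σ)
  | .lam a => .lam (a.bind fun n => match n with | 0 => .var 0 | m + 1 => (σ m).lift)

/-- Substitution of `s` for the variable `0` (β-contraction of `(λ.t) s`). -/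
def subst0 (t s : Tm C) : Tm C := t.bind fun n => match n with | 0 => s | m + 1 => .var m

end Tm

/-- Extended types `T⁺`: the constructors generate all expressions
`o | B | arr | ω | ε`; the grammar `T⁺ ::= T₁ | ω | ε`, `T₁ ::= T | T₁→T₁ | ω→T₁`
is captured by the predicate `IsT1` below. -/
inductive ETy (B : Type) : Type
  | o : ETy B
  | base : B → ETy B
  | arr : ETy B → ETy B → ETy B
  | omega : ETy B
  | eps : ETy B
deriving DecidableEq

/-- Membership in `T₁` (so `T⁺ = T₁ ∪ {ω, ε}`). -/
inductive IsT1 {B : Type} : ETy B → Prop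
  | o : IsT1 .o
  | base (b : B) : IsT1 (.base b)
  | arr {τ1 τ2 : ETy B} : IsT1 τ1 → IsT1 τ2 → IsT1 (.arr τ1 τ2)
  | omegaArr {τ2 : ETy B} : IsT1 τ2 → IsT1 (.arr .omega τ2)

/-- Membership in `T⁺`. -/
def IsTp {B : Type} (τ : ETy B) : Prop := IsT1 τ ∨ τ = .omega ∨ τ = .eps

/-- The normalized arrow `τ₁ → τ₂`, implementing the notational conventions
`τ→ε = ε` (for `τ ≠ ε`), `ε→τ = ω` and `τ→ω = ω`. -/
def arrN {B : Type} : ETy B → ETy B → ETy B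
  | _, .omega => .omega
  | .eps, _ => .omega
  | _, .eps => .eps
  | τ1, τ2 => .arr τ1 τ2

/-- The rank of a type. -/
def rank {B : Type} : ETy B → Nat
  | .arr τ1 τ2 => max (rank τ1 + 1) (rank τ2)
  | _ => 1

/-- A canonical system over domains `D` for the base types: the primitive
constants `Σ⁺ = {Ξ, L} ∪ {A_τ : τ ∈ B} ∪ ⋃_τ Σ_τ`, the sets `T_τ` of canonical
terms of each type, the distinguished canonical constants `⊤, ⊥` of type `o`,
and the function `F` associating to each canonical term of a function type its
set-theoretic function, as constructed in the paper from a full model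
`N = ⟨{D_τ}, I⟩` of classical higher-order logic.  The fields axiomatize the
construction: the sets of canonical terms of distinct types are disjoint sets of
closed normal terms (`T_ω` is the set of all terms, `T_ε = ∅`), for `τ₁ ≠ ω`
the canonical terms of type `τ₁→τ₂` are constants corresponding bijectively
(via `F`) to *all* set-theoretic functions from `T_{τ₁}` to `T_{τ₂}` (this is
where fullness of `N` enters), the canonical terms of type `ω→τ₂` are the terms
`λx.ρ` with `ρ ∈ T_{τ₂}` (with `F` giving constant functions), the canonical
terms of base type `b` correspond bijectively to the domain `D b`, and those
of type `o` are exactly `⊤` and `⊥`. -/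
structure CanSys (B : Type) (D : B → Type) where
  /-- the primitive constants `Σ⁺` -/
  C : Type
  cXi : C
  cL : C
  cA : B → C
  /-- the sets `T_τ` of canonical terms -/
  TT : ETy B → Set (Tm C)
  /-- the canonical constant `⊤ ∈ Σ_o` -/
  top : Tm C
  /-- the canonical constant `⊥ ∈ Σ_o` -/
  bot : Tm C
  /-- `F τ₁ τ₂ ρ t` : the value at `t ∈ T_{τ₁}` of the function associated with
  the canonical term `ρ ∈ T_{τ₁→τ₂}` -/
  F : ETy B → ETy B → Tm C → Tm C → Tm C
  hXiL : cXi ≠ cL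
  hXiA : ∀ b, cXi ≠ cA b
  hLA : ∀ b, cL ≠ cA b
  hAinj : Function.Injective cA
  TT_omega : TT .omega = Set.univ
  TT_eps : TT .eps = ∅
  TT_invalid : ∀ τ : ETy B, ¬ IsT1 τ → τ ≠ .omega → TT τ = ∅
  TT_o : TT .o = {top, bot}
  top_ne_bot : top ≠ bot
  TT_const : ∀ τ : ETy B, IsT1 τ → (∀ τ2, τ ≠ .arr .omega τ2) →
    ∀ t ∈ TT τ, ∃ c : C, t = .const c
  TT_base_equiv : ∀ b : B, Nonempty (D b ≃ TT (.base b))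
  TT_omega_arr : ∀ τ2 : ETy B, IsT1 τ2 → TT (.arr .omega τ2) = Tm.lam '' TT τ2
  F_omega : ∀ τ2 : ETy B, ∀ ρ ∈ TT τ2, ∀ t : Tm C, F .omega τ2 (.lam ρ) t = ρ
  F_mapsto : ∀ τ1 τ2 : ETy B, IsT1 (.arr τ1 τ2) →
    ∀ ρ ∈ TT (.arr τ1 τ2), ∀ t ∈ TT τ1, F τ1 τ2 ρ t ∈ TT τ2
  F_full : ∀ τ1 τ2 : ETy B, IsT1 (.arr τ1 τ2) → τ1 ≠ .omega →
    ∀ g : Tm C → Tm C, (∀ t ∈ TT τ1, g t ∈ TT τ2) →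
      ∃ ρ ∈ TT (.arr τ1 τ2), ∀ t ∈ TT τ1, F τ1 τ2 ρ t = g t
  F_inj : ∀ τ1 τ2 : ETy B, IsT1 (.arr τ1 τ2) → τ1 ≠ .omega →
    ∀ ρ ∈ TT (.arr τ1 τ2), ∀ ρ' ∈ TT (.arr τ1 τ2),
      (∀ t ∈ TT τ1, F τ1 τ2 ρ t = F τ1 τ2 ρ' t) → ρ = ρ'
  TT_disj : ∀ τ τ' : ETy B, τ ≠ τ' → τ ≠ .omega → τ' ≠ .omega →
    Disjoint (TT τ) (TT τ')
  prim_notin : ∀ τ : ETy B, τ ≠ .omega →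
    Tm.const cXi ∉ TT τ ∧ Tm.const cL ∉ TT τ ∧ ∀ b, Tm.const (cA b) ∉ TT τ
  cover : ∀ c : C, c = cXi ∨ c = cL ∨ (∃ b, c = cA b) ∨
    ∃ τ : ETy B, τ ≠ .omega ∧ Tm.const c ∈ TT τ

namespace CanSys

variable {B : Type} {D : B → Type} (S : CanSys B D)

/-- The term `Ξ`. -/
def XiT : Tm S.C := .const S.cXi

/-- The term `L`. -/
def LT : Tm S.C := .const S.cL

/-- The term `A_b`. -/
def AT (b : B) : Tm S.C := .const (S.cA b)

/-- `K t = λx.t` with `x ∉ FV(t)`. -/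
def Kt (t : Tm S.C) : Tm S.C := .lam t.lift

/-- `H t = L (K t)`. -/
def Ht (t : Tm S.C) : Tm S.C := .app S.LT (S.Kt t)

/-- The term `H = λx. L (K x)`. -/
def Hterm : Tm S.C := .lam (.app S.LT (.lam (.var 1)))

/-- `F t₁ t₂`, written out according to the notational convention:
`λf. Ξ t₁ (λx. t₂ (f x))` if `t₂` is not a λ-abstraction, and
`λf. Ξ t₁ (λx. q₂[z/(f x)])` if `t₂ = λz. q₂`. -/
def Ft (t1 t2 : Tm S.C) : Tm S.C :=
  .lam (.app (.app S.XiT t1.lift)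
    (match t2 with
     | .lam b => .lam (b.bind fun n => match n with
         | 0 => .app (.var 1) (.var 0)
         | m + 1 => .var (m + 2))
     | t2 => .lam (.app t2.lift.lift (.app (.var 1) (.var 0)))))

end CanSys


mutual
  /-- One-step reduction `→_{≤α}` of the reduction system `R_α`: the context
  closure of β- and η-reduction together with the rules `c t → F(c)(ρ₁)` for
  canonical constants `c ∈ Σ_{τ₁→τ₂}` (`τ₁ ≠ ω`) and `t ≻_{<α} ρ₁`. -/
  inductive Step {B : Type} {D : B → Type} (S : CanSys B D) :
      Ordinal.{0} → Tm S.C → Tm S.C → Prop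
    | beta (α : Ordinal.{0}) (t s : Tm S.C) : Step S α (.app (.lam t) s) (t.subst0 s)
    | eta (α : Ordinal.{0}) (t : Tm S.C) : Step S α (.lam (.app t.lift (.var 0))) t
    | crule {α γ : Ordinal.{0}} (hγ : γ < α) {τ1 τ2 : ETy B} (h1 : τ1 ≠ .omega)
        {c : Tm S.C} (hc : c ∈ S.TT (.arr τ1 τ2)) {ρ1 : Tm S.C} (hρ1 : ρ1 ∈ S.TT τ1)
        {t : Tm S.C} (hs : Succ S γ t ρ1) :
        Step S α (.app c t) (S.F τ1 τ2 c ρ1)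
    | appL {α : Ordinal.{0}} {t t' : Tm S.C} (s : Tm S.C) :
        Step S α t t' → Step S α (.app t s) (.app t' s)
    | appR (t : Tm S.C) {α : Ordinal.{0}} {s s' : Tm S.C} :
        Step S α s s' → Step S α (.app t s) (.app t s')
    | lam {α : Ordinal.{0}} {t t' : Tm S.C} :
        Step S α t t' → Step S α (.lam t) (.lam t')

  /-- Many-step reduction `↠_{≤α}` (the reflexive-transitive closure of `→_{≤α}`). -/
  inductive Steps {B : Type} {D : B → Type} (S : CanSys B D) :
      Ordinal.{0} → Tm S.C → Tm S.C → Prop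
    | refl (α : Ordinal.{0}) (t : Tm S.C) : Steps S α t t
    | tail {α : Ordinal.{0}} {t u v : Tm S.C} :
        Steps S α t u → Step S α u v → Steps S α t v

  /-- `t ⇝_α ρ` : `t ↠_{≤α} t' ≻_α ρ` for some `t'`. -/
  inductive Lead {B : Type} {D : B → Type} (S : CanSys B D) :
      Ordinal.{0} → Tm S.C → Tm S.C → Prop
    | mk {α : Ordinal.{0}} {t t' ρ : Tm S.C} :
        Steps S α t t' → Succ S α t' ρ → Lead S α t ρ

  /-- `t ⇝_{<α} ρ` : `t ⇝_γ ρ` for some `γ < α`. -/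
  inductive LeadLt {B : Type} {D : B → Type} (S : CanSys B D) :
      Ordinal.{0} → Tm S.C → Tm S.C → Prop
    | mk {α γ : Ordinal.{0}} {t ρ : Tm S.C} :
        γ < α → Lead S γ t ρ → LeadLt S α t ρ

  /-- The typing relation `t ∼_α τ` (Definition 4.4), by the rules
  (A), (H), (Kω), (Kε), (F) and (Fω). -/
  inductive Sim {B : Type} {D : B → Type} (S : CanSys B D) :
      Ordinal.{0} → Tm S.C → ETy B → Prop
    | ofA (α : Ordinal.{0}) (b : B) : Sim S α (S.AT b) (.base b)
    | ofH (α : Ordinal.{0}) : Sim S α S.Hterm .o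
    | ofKom {α : Ordinal.{0}} {t : Tm S.C} :
        LeadLt S α t S.top → Sim S α (S.Kt t) .omega
    | ofKeps {α : Ordinal.{0}} {t : Tm S.C} :
        LeadLt S α t S.bot → Sim S α (S.Kt t) .eps
    | ofF {α γ1 γ2 : Ordinal.{0}} (h1 : γ1 < α) (h2 : γ2 < α)
        {t1 t2 : Tm S.C} {τ1 τ2 : ETy B} :
        Sim S γ1 t1 τ1 → Sim S γ2 t2 τ2 → Sim S α (S.Ft t1 t2) (arrN τ1 τ2)
    | ofFom {α γ : Ordinal.{0}} (hγ : γ < α) {t1 t2 : Tm S.C} :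
        Sim S γ t1 .eps → Sim S α (S.Ft t1 t2) .omega

  /-- The relation `t ≻_α ρ` between terms and canonical terms (Definition 4.5). -/
  inductive Succ {B : Type} {D : B → Type} (S : CanSys B D) :
      Ordinal.{0} → Tm S.C → Tm S.C → Prop
    /- `ρ ≻_α ρ` for canonical `ρ` -/
    | refl {τ : ETy B} (hτ : τ ≠ .omega) {ρ : Tm S.C} (hρ : ρ ∈ S.TT τ)
        (α : Ordinal.{0}) : Succ S α ρ ρ
    /- `t ≻_α ρ` when `ρ` has canonical type `τ₁→τ₂` (possibly `τ₁ = ω`) and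
       `t t₁ ⇝_{<α} F(ρ)(t₁)` for all `t₁ ∈ T_{τ₁}` -/
    | fn {τ1 τ2 : ETy B} {ρ : Tm S.C} (hρ : ρ ∈ S.TT (.arr τ1 τ2))
        {α : Ordinal.{0}} {t : Tm S.C}
        (h : ∀ t1 ∈ S.TT τ1, LeadLt S α (.app t t1) (S.F τ1 τ2 ρ t1)) :
        Succ S α t ρ
    /- base postulates for `t ≻_α ⊤` -/
    | topLA (α : Ordinal.{0}) (b : B) : Succ S α (.app S.LT (S.AT b)) S.top
    | topLH (α : Ordinal.{0}) : Succ S α (.app S.LT S.Hterm) S.top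
    | topA {b : B} {c : Tm S.C} (hc : c ∈ S.TT (.base b)) (α : Ordinal.{0}) :
        Succ S α (.app (S.AT b) c) S.top
    | topH {c : Tm S.C} (hc : c = S.top ∨ c = S.bot) (α : Ordinal.{0}) :
        Succ S α (S.Ht c) S.top
    /- `(Ξ_i^⊤)` -/
    | xiTop {α : Ordinal.{0}} (hα : 0 < α) {t1 t2 : Tm S.C} {τ : ETy B}
        (h1 : Sim S α t1 τ) (h2 : ∀ t3 ∈ S.TT τ, LeadLt S α (.app t2 t3) S.top) :
        Succ S α (.app (.app S.XiT t1) t2) S.top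
    /- `(Ξ_H^⊤)` -/
    | xiHTop {α : Ordinal.{0}} (hα : 0 < α) {t1 t2 : Tm S.C} {τ : ETy B}
        (h1 : Sim S α t1 τ)
        (h2 : ∀ t3 ∈ S.TT τ, LeadLt S α (S.Ht (.app t2 t3)) S.top) :
        Succ S α (S.Ht (.app (.app S.XiT t1) t2)) S.top
    /- `(F_L^⊤)`, first case: `t₁ ∼_α ε` -/
    | flTopEps {α : Ordinal.{0}} (hα : 0 < α) {t1 t2 : Tm S.C}
        (h1 : Sim S α t1 .eps) :
        Succ S α (.app S.LT (S.Ft t1 t2)) S.top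
    /- `(F_L^⊤)`, second case: `t₁ ∼_α τ` for some `τ ≠ ε` and `L t₂ ⇝_{<α} ⊤` -/
    | flTop {α : Ordinal.{0}} (hα : 0 < α) {t1 t2 : Tm S.C} {τ : ETy B}
        (hτ : τ ≠ .eps) (h1 : Sim S α t1 τ) (h2 : LeadLt S α (.app S.LT t2) S.top) :
        Succ S α (.app S.LT (S.Ft t1 t2)) S.top
    /- `(H_i^⊤)` -/
    | hiTop {α : Ordinal.{0}} (hα : 0 < α) {t1 : Tm S.C} (h : LeadLt S α t1 S.top) :
        Succ S α (S.Ht t1) S.top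
    /- `(Ξ^⊥)` -/
    | xiBot {α : Ordinal.{0}} (hα : 0 < α) {t1 t2 : Tm S.C} {τ : ETy B}
        {γ : Ordinal.{0}} (hγ : γ < α)
        (hH : Succ S γ (S.Ht (.app (.app S.XiT t1) t2)) S.top)
        (h1 : Sim S α t1 τ) {t3 : Tm S.C} (h3 : t3 ∈ S.TT τ)
        (hb : LeadLt S α (.app t2 t3) S.bot) :
        Succ S α (.app (.app S.XiT t1) t2) S.bot
end


variable {B : Type} {D : B → Type}

/-- `t ≻ ρ` : the stable relation `≻_ζ` at the closure ordinal (by monotonicity,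
it equals the union of the `≻_α` over all ordinals `α`). -/
def SuccS (S : CanSys B D) (t ρ : Tm S.C) : Prop := ∃ α : Ordinal.{0}, Succ S α t ρ

/-- `t ∼ τ` : the stable typing relation. -/
def SimS (S : CanSys B D) (t : Tm S.C) (τ : ETy B) : Prop := ∃ α : Ordinal.{0}, Sim S α t τ

/-- One-step reduction of the stable reduction system `R`. -/
def StepR (S : CanSys B D) (t t' : Tm S.C) : Prop := ∃ α : Ordinal.{0}, Step S α t t'

/-- `t ↠_R t'` : many-step reduction in the stable reduction system `R`. -/
def StepsR (S : CanSys B D) : Tm S.C → Tm S.C → Prop := Relation.ReflTransGen (StepR S)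

/-- `t ⇝ ρ` : the stable relation `⇝_ζ`. -/
def LeadR (S : CanSys B D) (t ρ : Tm S.C) : Prop :=
  ∃ t', StepsR S t t' ∧ SuccS S t' ρ

/-- `t =_{≤α} t'` : convertibility in `R_α`. -/
def ConvLe (S : CanSys B D) (α : Ordinal.{0}) : Tm S.C → Tm S.C → Prop :=
  Relation.EqvGen (Step S α)

/-- `t =_R t'` : convertibility in the stable reduction system `R`. -/
def ConvR (S : CanSys B D) : Tm S.C → Tm S.C → Prop :=
  Relation.EqvGen (StepR S)

/-- Filling the boxes `□₁, …, □ₖ` of a `k`-ary context (a λ-term over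
`Σ⁺ ∪ {□₁, …, □ₖ}`) with terms, in such a way that the free variables of the
inserted terms do not become bound. -/
def fillk {C : Type} {k : Nat} (ts : Fin k → Tm C) : Tm (Fin k ⊕ C) → Tm C
  | .var n => .var n
  | .const (.inl i) => ts i
  | .const (.inr c) => .const c
  | .app a b => .app (fillk ts a) (fillk ts b)
  | .lam a => .lam (fillk (fun i => (ts i).lift) a)

/-- Filling a unary context. -/
def fill1 {C : Type} (Ctx : Tm (Fin 1 ⊕ C)) (t : Tm C) : Tm C :=
  fillk (fun _ => t) Ctx

/-- `t ≫^n t'` (at the stable level): there are a `k`-ary context `Cx`, terms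
`t₁, …, t_k` and canonical terms `ρ₁, …, ρ_k` of ranks `≤ n` with `tᵢ ≻ ρᵢ`,
`t = Cx[t₁,…,t_k]` and `t' = Cx[ρ₁,…,ρ_k]`. -/
def Gg (S : CanSys B D) (n : Nat) (t t' : Tm S.C) : Prop :=
  ∃ (k : Nat) (Cx : Tm (Fin k ⊕ S.C)) (ts ρs : Fin k → Tm S.C),
    (∀ i, SuccS S (ts i) (ρs i)) ∧
    (∀ i, ∃ τ : ETy B, τ ≠ .omega ∧ ρs i ∈ S.TT τ ∧ rank τ ≤ n) ∧
    t = fillk ts Cx ∧ t' = fillk ρs Cx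


namespace Tm

variable {C : Type}

/-- A substitution pushed under a binder. -/
def up (σ : Nat → Tm C) : Nat → Tm C
  | 0 => .var 0
  | m + 1 => (σ m).lift

/-- A renaming pushed under a binder. -/
def upr (f : Nat → Nat) : Nat → Nat
  | 0 => 0
  | m + 1 => f m + 1

theorem bind_lam (σ : Nat → Tm C) (a : Tm C) : (Tm.lam a).bind σ = .lam (a.bind (up σ)) := by
  simp only [bind]
  congr 2

theorem rename_lam (f : Nat → Nat) (a : Tm C) :
    (Tm.lam a).rename f = .lam (a.rename (upr f)) := by
  simp only [rename]
  congr 2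

theorem rename_eq_bind (f : Nat → Nat) (t : Tm C) : t.rename f = t.bind (fun n => .var (f n)) := by
  induction t generalizing f with
  | var n => rfl
  | const c => rfl
  | app a b iha ihb => simp only [rename, bind, iha, ihb]
  | lam a ih =>
    rw [rename_lam, bind_lam, ih]
    congr 2
    funext n
    cases n <;> rfl

theorem bind_var (t : Tm C) : t.bind .var = t := by
  induction t with
  | var n => rfl
  | const c => rfl
  | app a b iha ihb => simp only [bind, iha, ihb]
  | lam a ih =>
    rw [bind_lam]
    have : up (.var : Nat → Tm C) = .var := by
      funext n
      cases n <;> rfl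
    rw [this, ih]

theorem bind_rename (σ : Nat → Tm C) (f : Nat → Nat) (t : Tm C) :
    (t.rename f).bind σ = t.bind (fun n => σ (f n)) := by
  induction t generalizing f σ with
  | var n => rfl
  | const c => rfl
  | app a b iha ihb => simp only [rename, bind, iha, ihb]
  | lam a ih =>
    rw [rename_lam, bind_lam, bind_lam, ih]
    congr 2
    funext n
    cases n <;> rfl

theorem rename_rename (f g : Nat → Nat) (t : Tm C) :
    (t.rename f).rename g = t.rename fun n => g (f n) := by
  rw [rename_eq_bind g, bind_rename, rename_eq_bind]

theorem rename_bind (σ : Nat → Tm C) (f : Nat → Nat) (t : Tm C) :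
    (t.bind σ).rename f = t.bind (fun n => (σ n).rename f) := by
  induction t generalizing f σ with
  | var n => rfl
  | const c => rfl
  | app a b iha ihb => simp only [rename, bind, iha, ihb]
  | lam a ih =>
    rw [bind_lam, rename_lam, bind_lam, ih]
    congr 2
    funext n
    cases n with
    | zero => rfl
    | succ n =>
      simp only [up, lift, rename_rename]
      rfl

theorem bind_bind (σ τ : Nat → Tm C) (t : Tm C) :
    (t.bind σ).bind τ = t.bind (fun n => (σ n).bind τ) := by
  induction t generalizing σ τ with
  | var n => rfl
  | const c => rfl
  | app a b iha ihb => simp only [bind, iha, ihb]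
  | lam a ih =>
    rw [bind_lam, bind_lam, bind_lam, ih]
    congr 2
    funext n
    cases n with
    | zero => rfl
    | succ n => simp only [up, lift, rename_bind, bind_rename]

theorem lift_eq_bind (t : Tm C) : t.lift = t.bind (fun n => .var (n + 1)) :=
  rename_eq_bind _ t

theorem lift_bind (σ : Nat → Tm C) (t : Tm C) : t.lift.bind σ = t.bind (fun n => σ (n + 1)) :=
  bind_rename _ _ t

theorem lift_bind_up (σ : Nat → Tm C) (t : Tm C) : t.lift.bind (up σ) = (t.bind σ).lift := by
  rw [lift_bind, lift, rename_bind]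
  rfl

/-- Substitution sending the variable `0` to `s` and lowering the others. -/
def inst (s : Tm C) : Nat → Tm C
  | 0 => s
  | m + 1 => .var m

theorem subst0_eq (t s : Tm C) : t.subst0 s = t.bind (inst s) := by
  rw [subst0]
  congr 1

theorem lift_bind_inst (s t : Tm C) : t.lift.bind (inst s) = t := by
  rw [lift_bind]
  exact bind_var t

theorem lam_lift (t : Tm C) : (Tm.lam t).lift = .lam (t.bind (up fun n => .var (n + 1))) := by
  rw [lift_eq_bind, bind_lam]

theorem bind_up_bind (σ τ : Nat → Tm C) (t : Tm C) :
    (t.bind (up σ)).bind τ =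
      t.bind (fun n => match n with | 0 => τ 0 | m + 1 => (σ m).bind fun k => τ (k + 1)) := by
  rw [bind_bind]
  congr 1
  funext n
  cases n with
  | zero => rfl
  | succ n => exact lift_bind _ _

theorem bind_up_lift_inst (t : Tm C) :
    (t.bind (up fun n => .var (n + 1))).bind (inst (.var 0)) = t := by
  rw [bind_up_bind]
  conv_rhs => rw [← bind_var t]
  congr 1
  funext n
  cases n <;> rfl

theorem subst0_bind (σ : Nat → Tm C) (t s : Tm C) :
    (t.subst0 s).bind σ = (t.bind (up σ)).subst0 (s.bind σ) := by
  rw [subst0_eq, subst0_eq, bind_bind, bind_up_bind]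
  congr 1
  funext n
  cases n with
  | zero => rfl
  | succ n => exact (bind_var _).symm

/-- All free variables of the term satisfy `P`. -/
def FV : (Nat → Prop) → Tm C → Prop
  | P, .var n => P n
  | _, .const _ => True
  | P, .app a b => a.FV P ∧ b.FV P
  | P, .lam a => a.FV fun n => ∀ m, n = m + 1 → P m

theorem FV.mono {P Q : Nat → Prop} {t : Tm C} (h : ∀ n, P n → Q n) (ht : t.FV P) : t.FV Q := by
  induction t generalizing P Q with
  | var n => exact h _ ht
  | const c => trivial
  | app a b iha ihb => exact ⟨iha h ht.1, ihb h ht.2⟩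
  | lam a ih => exact ih (fun n hn m hm => h _ (hn m hm)) ht

theorem FV.of_rename {P : Nat → Prop} {f : Nat → Nat} {t : Tm C} (h : (t.rename f).FV P) :
    t.FV fun n => P (f n) := by
  induction t generalizing P f with
  | var n => exact h
  | const c => trivial
  | app a b iha ihb => exact ⟨iha h.1, ihb h.2⟩
  | lam a ih =>
    rw [rename_lam] at h
    refine (ih (P := fun n => ∀ m, n = m + 1 → P m) h).mono ?_
    rintro n hn m rfl
    exact hn _ rfl

theorem FV.bind {P Q : Nat → Prop} {σ : Nat → Tm C} {t : Tm C} (ht : t.FV P)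
    (h : ∀ n, P n → (σ n).FV Q) : (t.bind σ).FV Q := by
  induction t generalizing P Q σ with
  | var n => exact h _ ht
  | const c => trivial
  | app a b iha ihb => exact ⟨iha ht.1 h, ihb ht.2 h⟩
  | lam a ih =>
    rw [bind_lam]
    refine ih (P := fun n => ∀ m, n = m + 1 → P m) ht ?_
    have key : ∀ {R : Nat → Prop} {s : Tm C} {f : Nat → Nat}, s.FV (fun n => R (f n)) →
        (s.rename f).FV R := by
      intro R s
      induction s generalizing R with
      | var n => exact fun h => h
      | const c => exact fun _ => trivial
      | app a b iha ihb => exact fun h => ⟨iha h.1, ihb h.2⟩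
      | lam a ih =>
        intro f h
        rw [rename_lam]
        refine ih (R := fun n => ∀ m, n = m + 1 → R m) (FV.mono ?_ h)
        intro n hn m hm
        cases n with
        | zero => simp [upr] at hm
        | succ n =>
          simp only [upr, Nat.add_right_cancel_iff] at hm
          exact hm ▸ hn n rfl
    intro n hn
    cases n with
    | zero =>
      intro m hm
      simp at hm
    | succ n =>
      refine key ((h n (hn n rfl)).mono ?_)
      intro k hk m hm
      simp only [Nat.add_right_cancel_iff] at hm
      exact hm ▸ hk

theorem FV.bind_congr {P : Nat → Prop} {σ τ : Nat → Tm C} {t : Tm C} (ht : t.FV P)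
    (h : ∀ n, P n → σ n = τ n) : t.bind σ = t.bind τ := by
  induction t generalizing P σ τ with
  | var n => exact h _ ht
  | const c => rfl
  | app a b iha ihb => simp only [Tm.bind, iha ht.1 h, ihb ht.2 h]
  | lam a ih =>
    rw [bind_lam, bind_lam, ih (P := fun n => ∀ m, n = m + 1 → P m) ht]
    intro n hn
    cases n with
    | zero => rfl
    | succ n => simp only [up, h n (hn n rfl)]

theorem exists_FV_lt (t : Tm C) : ∃ N, t.FV (· < N) := by
  induction t with
  | var n => exact ⟨n + 1, Nat.lt_succ_self n⟩
  | const c => exact ⟨0, trivial⟩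
  | app a b iha ihb =>
    obtain ⟨N, hN⟩ := iha
    obtain ⟨M, hM⟩ := ihb
    exact ⟨max N M, hN.mono fun n h => lt_max_of_lt_left h, hM.mono fun n h => lt_max_of_lt_right h⟩
  | lam a ih =>
    obtain ⟨N, hN⟩ := ih
    refine ⟨N, hN.mono ?_⟩
    rintro n hn m rfl
    omega

theorem FV.true (t : Tm C) : t.FV fun _ => True := by
  obtain ⟨N, hN⟩ := t.exists_FV_lt
  exact hN.mono fun _ _ => trivial

theorem lift_FV (t : Tm C) : t.lift.FV (· ≠ 0) := by
  rw [lift_eq_bind]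
  exact (FV.true t).bind fun n _ => Nat.succ_ne_zero n

theorem FV.eq_lift {t : Tm C} (h : t.FV (· ≠ 0)) : t = (t.bind (inst (.var 0))).lift := by
  rw [lift, rename_bind]
  conv_lhs => rw [← bind_var t]
  refine h.bind_congr fun n hn => ?_
  cases n with
  | zero => exact absurd rfl hn
  | succ n => rfl

/-- The number of constructors of a term. -/
def size : Tm C → Nat
  | .var _ => 1
  | .const _ => 1
  | .app a b => a.size + b.size + 1
  | .lam a => a.size + 1

theorem size_rename (f : Nat → Nat) (t : Tm C) : (t.rename f).size = t.size := by
  induction t generalizing f with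
  | var n => rfl
  | const c => rfl
  | app a b iha ihb => simp only [rename, size, iha, ihb]
  | lam a ih => simp only [rename, size, ih]

/-- Terms of the form `x t₁ … tₖ` with head variable `n`. -/
inductive Neu : Nat → Tm C → Prop
  | var (n : Nat) : Neu n (.var n)
  | app {n : Nat} {t : Tm C} (s : Tm C) : Neu n t → Neu n (.app t s)

theorem Neu.bind {n m : Nat} {t : Tm C} {σ : Nat → Tm C} (h : Neu n t) (hσ : Neu m (σ n)) :
    Neu m (t.bind σ) := by
  induction h with
  | var => exact hσ
  | app s _ ih => exact .app _ ih

theorem Neu.lift {n : Nat} {t : Tm C} (h : Neu n t) : Neu (n + 1) t.lift := by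
  rw [lift_eq_bind]
  exact h.bind (.var _)

/-- Constants under a sequence of vacuous abstractions; all canonical terms have this form. -/
inductive LamConst : Tm C → Prop
  | const (c : C) : LamConst (.const c)
  | lam {t : Tm C} : LamConst t → LamConst (.lam t)

theorem LamConst.bind {t : Tm C} (h : LamConst t) (σ : Nat → Tm C) : t.bind σ = t := by
  induction h generalizing σ with
  | const c => rfl
  | lam _ ih => rw [bind_lam, ih]

end Tm

open Relation (ReflTransGen)

namespace CanSys

variable {B : Type} {D : B → Type} (S : CanSys B D)

theorem isT1_of_mem {S : CanSys B D} {τ : ETy B} (hτ : τ ≠ .omega) {ρ : Tm S.C}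
    (h : ρ ∈ S.TT τ) : IsT1 τ := by
  by_contra hn
  rw [S.TT_invalid τ hn hτ] at h
  exact h

theorem _root_.ILM.IsT1.ne_omega {τ : ETy B} (h : IsT1 τ) : τ ≠ .omega := by
  rintro rfl
  cases h

theorem _root_.ILM.IsT1.cod {τ1 τ2 : ETy B} (h : IsT1 (.arr τ1 τ2)) : IsT1 τ2 := by
  cases h <;> assumption

theorem mem_unique {S : CanSys B D} {τ τ' : ETy B} (hτ : τ ≠ .omega) (hτ' : τ' ≠ .omega)
    {ρ : Tm S.C} (h : ρ ∈ S.TT τ) (h' : ρ ∈ S.TT τ') : τ = τ' := by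
  by_contra hne
  exact Set.disjoint_left.mp (S.TT_disj τ τ' hne hτ hτ') h h'

theorem top_mem : S.top ∈ S.TT .o := by simp [S.TT_o]

theorem bot_mem : S.bot ∈ S.TT .o := by simp [S.TT_o]

theorem mem_o {S : CanSys B D} {ρ : Tm S.C} (h : ρ ∈ S.TT .o) : ∃ c, ρ = .const c :=
  S.TT_const .o .o (by simp) ρ h

theorem lamConst_of_mem {S : CanSys B D} {τ : ETy B} (hτ : τ ≠ .omega) {ρ : Tm S.C}
    (h : ρ ∈ S.TT τ) : ρ.LamConst := by
  induction τ generalizing ρ with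
  | arr τ1 τ2 _ ih2 =>
    have hT := isT1_of_mem hτ h
    by_cases hom : τ1 = .omega
    · subst hom
      rw [S.TT_omega_arr τ2 hT.cod] at h
      obtain ⟨ρ', h', rfl⟩ := h
      exact .lam (ih2 hT.cod.ne_omega h')
    · obtain ⟨c, rfl⟩ := S.TT_const _ hT (fun τ2' he => hom (by cases he; rfl)) ρ h
      exact .const c
  | omega => exact absurd rfl hτ
  | _ =>
    obtain ⟨c, rfl⟩ := S.TT_const _ (isT1_of_mem hτ h) (by simp) ρ h
    exact .const c

theorem mem_bind {S : CanSys B D} {τ : ETy B} {ρ : Tm S.C} (h : ρ ∈ S.TT τ)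
    (σ : Nat → Tm S.C) : ρ.bind σ ∈ S.TT τ := by
  by_cases hτ : τ = .omega
  · subst hτ
    rw [S.TT_omega]
    trivial
  · rwa [(lamConst_of_mem hτ h).bind]

/-- Every genuine type has a canonical term. -/
theorem nonempty_of_isT1 (hD : ∀ b, Nonempty (D b)) {τ : ETy B} (h : IsT1 τ) :
    (S.TT τ).Nonempty := by
  induction h with
  | o => exact ⟨_, S.top_mem⟩
  | base b =>
    obtain ⟨e⟩ := S.TT_base_equiv b
    obtain ⟨d⟩ := hD b
    exact ⟨e d, (e d).2⟩
  | arr h1 h2 _ ih2 =>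
    obtain ⟨ρ, hρ⟩ := ih2
    obtain ⟨ρ', h', _⟩ := S.F_full _ _ (.arr h1 h2) h1.ne_omega (fun _ => ρ) (fun _ _ => hρ)
    exact ⟨ρ', h'⟩
  | omegaArr h2 ih2 =>
    obtain ⟨ρ, hρ⟩ := ih2
    rw [S.TT_omega_arr _ h2]
    exact ⟨_, ρ, hρ, rfl⟩

theorem nonempty_dom (hD : ∀ b, Nonempty (D b)) {τ1 τ2 : ETy B} (h : IsT1 (.arr τ1 τ2)) :
    (S.TT τ1).Nonempty := by
  cases h with
  | arr h1 _ => exact S.nonempty_of_isT1 hD h1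
  | omegaArr _ =>
    rw [S.TT_omega]
    exact ⟨S.top, trivial⟩

theorem F_mem {S : CanSys B D} {τ1 τ2 : ETy B} {ρ t : Tm S.C} (hρ : ρ ∈ S.TT (.arr τ1 τ2))
    (ht : t ∈ S.TT τ1) : S.F τ1 τ2 ρ t ∈ S.TT τ2 :=
  S.F_mapsto τ1 τ2 (isT1_of_mem (by simp) hρ) ρ hρ t ht

theorem F_omega_congr {S : CanSys B D} {τ2 : ETy B} {ρ : Tm S.C}
    (hρ : ρ ∈ S.TT (.arr .omega τ2)) (s t : Tm S.C) :
    S.F .omega τ2 ρ s = S.F .omega τ2 ρ t := by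
  rw [S.TT_omega_arr τ2 (isT1_of_mem (by simp) hρ).cod] at hρ
  obtain ⟨ρ', h', rfl⟩ := hρ
  rw [S.F_omega _ _ h', S.F_omega _ _ h']

/-- Extensionality of canonical terms of function types. -/
theorem ext_of_F {S : CanSys B D} {τ1 τ2 : ETy B} {ρ ρ' : Tm S.C} (hρ : ρ ∈ S.TT (.arr τ1 τ2))
    (hρ' : ρ' ∈ S.TT (.arr τ1 τ2)) (h : ∀ t ∈ S.TT τ1, S.F τ1 τ2 ρ t = S.F τ1 τ2 ρ' t) :
    ρ = ρ' := by
  have hT := isT1_of_mem (by simp) hρ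
  by_cases hom : τ1 = .omega
  · subst hom
    have h0 := h S.top (by rw [S.TT_omega]; trivial)
    rw [S.TT_omega_arr τ2 hT.cod] at hρ hρ'
    obtain ⟨r, hr, rfl⟩ := hρ
    obtain ⟨r', hr', rfl⟩ := hρ'
    rw [S.F_omega _ _ hr, S.F_omega _ _ hr'] at h0
    rw [h0]
  · exact S.F_inj _ _ hT hom _ hρ _ hρ' h

/-- The canonical terms of some type other than `ω`. -/
def Can (ρ : Tm S.C) : Prop := ∃ τ : ETy B, τ ≠ .omega ∧ ρ ∈ S.TT τ

theorem Can.lamConst {S : CanSys B D} {ρ : Tm S.C} (h : S.Can ρ) : ρ.LamConst := by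
  obtain ⟨τ, hτ, h⟩ := h
  exact lamConst_of_mem hτ h

end CanSys

variable {S : CanSys B D}

/-- Parallel reduction, with the rules `c t → F(c)(ρ)` for `c ∈ Σ_{τ₁→τ₂}` and `L t ρ`. -/
inductive PRed (S : CanSys B D) (L : Tm S.C → Tm S.C → Prop) : Tm S.C → Tm S.C → Prop
  | var (n : Nat) : PRed S L (.var n) (.var n)
  | const (c : S.C) : PRed S L (.const c) (.const c)
  | app {a a' b b' : Tm S.C} : PRed S L a a' → PRed S L b b' → PRed S L (.app a b) (.app a' b')
  | lam {a a' : Tm S.C} : PRed S L a a' → PRed S L (.lam a) (.lam a')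
  | beta {a a' b b' : Tm S.C} : PRed S L a a' → PRed S L b b' →
      PRed S L (.app (.lam a) b) (a'.subst0 b')
  | eta {a a' : Tm S.C} : PRed S L a a' → PRed S L (.lam (.app a.lift (.var 0))) a'
  | can {τ1 τ2 : ETy B} (h1 : τ1 ≠ .omega) {c : Tm S.C} (hc : c ∈ S.TT (.arr τ1 τ2))
      {ρ : Tm S.C} (hρ : ρ ∈ S.TT τ1) {t : Tm S.C} (h : L t ρ) :
      PRed S L (.app c t) (S.F τ1 τ2 c ρ)

/-- Iterated parallel reduction. -/
abbrev PReds (S : CanSys B D) (L : Tm S.C → Tm S.C → Prop) : Tm S.C → Tm S.C → Prop :=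
  ReflTransGen (PRed S L)

variable {L L' L1 L2 : Tm S.C → Tm S.C → Prop} {t t' s s' : Tm S.C}

namespace PRed

theorem refl (t : Tm S.C) : PRed S L t t := by
  induction t with
  | var n => exact .var n
  | const c => exact .const c
  | app a b iha ihb => exact .app iha ihb
  | lam a ih => exact .lam ih

theorem mono (hL : ∀ t ρ, L t ρ → L' t ρ) (h : PRed S L t t') : PRed S L' t t' := by
  induction h with
  | var n => exact .var n
  | const c => exact .const c
  | app _ _ iha ihb => exact .app iha ihb
  | lam _ ih => exact .lam ih
  | beta _ _ iha ihb => exact .beta iha ihb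
  | eta _ ih => exact .eta ih
  | can h1 hc hρ h => exact .can h1 hc hρ (hL _ _ h)

theorem bind_of_up (hL : ∀ t ρ σ, L t ρ → L (t.bind σ) ρ) (h : PRed S L t t')
    (P : (Nat → Tm S.C) → (Nat → Tm S.C) → Prop) (hP : ∀ σ σ', P σ σ' → P (Tm.up σ) (Tm.up σ'))
    (hP' : ∀ σ σ', P σ σ' → ∀ n, PRed S L (σ n) (σ' n)) {σ σ' : Nat → Tm S.C} (hσ : P σ σ') :
    PRed S L (t.bind σ) (t'.bind σ') := by
  induction h generalizing σ σ' with
  | var n => exact hP' _ _ hσ n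
  | const c => exact .const c
  | app _ _ iha ihb => exact .app (iha hσ) (ihb hσ)
  | lam _ ih =>
    rw [Tm.bind_lam, Tm.bind_lam]
    exact .lam (ih (hP _ _ hσ))
  | beta _ _ iha ihb =>
    rw [Tm.subst0_bind, Tm.bind, Tm.bind_lam]
    exact .beta (iha (hP _ _ hσ)) (ihb hσ)
  | eta _ ih =>
    rw [Tm.bind_lam, Tm.bind, Tm.lift_bind_up]
    exact .eta (ih hσ)
  | can h1 hc hρ h =>
    rw [Tm.bind, (CanSys.lamConst_of_mem (by simp) hc).bind,
      (CanSys.lamConst_of_mem (CanSys.isT1_of_mem (by simp) hc).cod.ne_omega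
        (CanSys.F_mem hc hρ)).bind]
    exact .can h1 hc hρ (hL _ _ _ h)

theorem rename (hL : ∀ t ρ σ, L t ρ → L (t.bind σ) ρ) (h : PRed S L t t') (f : Nat → Nat) :
    PRed S L (t.rename f) (t'.rename f) := by
  rw [Tm.rename_eq_bind, Tm.rename_eq_bind]
  refine h.bind_of_up hL (fun σ σ' => σ = σ' ∧ ∃ f : Nat → Nat, σ = fun n => .var (f n)) ?_ ?_
    ⟨rfl, f, rfl⟩
  · rintro σ _ ⟨rfl, f, rfl⟩
    refine ⟨rfl, Tm.upr f, ?_⟩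
    funext n
    cases n <;> rfl
  · rintro σ _ ⟨rfl, f, rfl⟩ n
    exact .var _

theorem lift (hL : ∀ t ρ σ, L t ρ → L (t.bind σ) ρ) (h : PRed S L t t') :
    PRed S L t.lift t'.lift :=
  h.rename hL _

theorem bind (hL : ∀ t ρ σ, L t ρ → L (t.bind σ) ρ) (h : PRed S L t t') {σ σ' : Nat → Tm S.C}
    (hσ : ∀ n, PRed S L (σ n) (σ' n)) : PRed S L (t.bind σ) (t'.bind σ') := by
  refine h.bind_of_up hL (fun σ σ' => ∀ n, PRed S L (σ n) (σ' n)) ?_ (fun _ _ h => h) hσ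
  intro σ σ' hσ n
  cases n with
  | zero => exact .var 0
  | succ n => exact (hσ n).lift hL

theorem subst0 (hL : ∀ t ρ σ, L t ρ → L (t.bind σ) ρ) (h : PRed S L t t') (hs : PRed S L s s') :
    PRed S L (t.subst0 s) (t'.subst0 s') := by
  rw [Tm.subst0_eq, Tm.subst0_eq]
  refine h.bind hL fun n => ?_
  cases n with
  | zero => exact hs
  | succ n => exact .var n

theorem FV {P : Nat → Prop} (h : PRed S L t t') (ht : t.FV P) : t'.FV P := by
  induction h generalizing P with
  | var n => exact ht
  | const c => exact ht
  | app _ _ iha ihb => exact ⟨iha ht.1, ihb ht.2⟩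
  | lam _ ih => exact ih (P := fun n => ∀ m, n = m + 1 → P m) ht
  | beta _ _ iha ihb =>
    rw [Tm.subst0_eq]
    refine (iha (P := fun n => ∀ m, n = m + 1 → P m) ht.1).bind fun n hn => ?_
    cases n with
    | zero => exact ihb ht.2
    | succ n => exact hn n rfl
  | eta _ ih =>
    refine ih ((Tm.FV.of_rename (f := (· + 1)) (P := fun n => ∀ m, n = m + 1 → P m) ht.1).mono ?_)
    exact fun n hn => hn n rfl
  | can h1 hc hρ h =>
    rw [← (CanSys.lamConst_of_mem (CanSys.isT1_of_mem (by simp) hc).cod.ne_omega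
      (CanSys.F_mem hc hρ)).bind fun _ => .const S.cL]
    exact (Tm.FV.true _).bind fun _ _ => trivial

/-- Reducts of a lifted term are lifted. -/
theorem of_lift (hL : ∀ t ρ σ, L t ρ → L (t.bind σ) ρ) (h : PRed S L t.lift s) :
    ∃ t', s = t'.lift ∧ PRed S L t t' := by
  refine ⟨_, (h.FV t.lift_FV).eq_lift, ?_⟩
  have := h.bind hL (σ := Tm.inst (.var 0)) (fun n => refl _)
  rwa [Tm.lift_bind_inst] at this

theorem eq_of_lamConst (h : PRed S L t t') (ht : t.LamConst) : t' = t := by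
  induction h with
  | const => rfl
  | lam _ ih =>
    cases ht with
    | lam ht => rw [ih ht]
  | eta => nomatch ht
  | _ => nomatch ht

theorem neu {n : Nat} (h : PRed S L t t') (ht : Tm.Neu n t) : Tm.Neu n t' := by
  induction h with
  | var => exact ht
  | app _ _ iha _ =>
    cases ht with
    | app _ ht => exact .app _ (iha ht)
  | beta =>
    cases ht with
    | app _ ht => nomatch ht
  | can h1 hc =>
    cases ht with
    | app _ ht =>
      have := CanSys.lamConst_of_mem (by simp) hc
      cases this <;> nomatch ht
  | _ => nomatch ht

/-- The non-canonical constants `Ξ`, `L`, `A_b`. -/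
def _root_.ILM.IsPrim (S : CanSys B D) (c : S.C) : Prop :=
  c = S.cXi ∨ c = S.cL ∨ ∃ b, c = S.cA b

theorem _root_.ILM.IsPrim.notMem {c : S.C} (hc : IsPrim S c) {τ : ETy B} (hτ : τ ≠ .omega) :
    Tm.const c ∉ S.TT τ := by
  obtain ⟨h1, h2, h3⟩ := S.prim_notin τ hτ
  rcases hc with rfl | rfl | ⟨b, rfl⟩
  exacts [h1, h2, h3 b]

theorem prim_app {c : S.C} (hc : IsPrim S c) (h : PRed S L (.app (.const c) t) s) :
    ∃ t', s = .app (.const c) t' ∧ PRed S L t t' := by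
  cases h with
  | app h1 h2 =>
    cases h1
    exact ⟨_, rfl, h2⟩
  | can _ h => exact absurd h (hc.notMem (by simp))

theorem prim_app_app {c : S.C} {a b : Tm S.C} (hc : IsPrim S c)
    (h : PRed S L (.app (.app (.const c) a) b) s) :
    ∃ a' b', s = .app (.app (.const c) a') b' ∧ PRed S L a a' ∧ PRed S L b b' := by
  cases h with
  | app h1 h2 =>
    obtain ⟨a', rfl, ha⟩ := h1.prim_app hc
    exact ⟨a', _, rfl, ha, h2⟩
  | can _ h => nomatch CanSys.lamConst_of_mem (by simp) h

end PRed

theorem isPrim_Xi : IsPrim S S.cXi := .inl rfl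

theorem isPrim_L : IsPrim S S.cL := .inr (.inl rfl)

theorem isPrim_A (b : B) : IsPrim S (S.cA b) := .inr (.inr ⟨b, rfl⟩)

namespace PReds

theorem app (ht : PReds S L t t') (hs : PReds S L s s') :
    PReds S L (.app t s) (.app t' s') :=
  (ht.lift (fun x => Tm.app x s) fun _ _ h => .app h (.refl s)).trans
    (hs.lift (fun x => Tm.app t' x) fun _ _ h => .app (.refl t') h)

theorem mono (hL : ∀ t ρ, L t ρ → L' t ρ) (h : PReds S L t t') : PReds S L' t t' :=
  h.lift id fun _ _ h => h.mono hL

theorem bind (hL : ∀ t ρ σ, L t ρ → L (t.bind σ) ρ) (h : PReds S L t t') (σ : Nat → Tm S.C) :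
    PReds S L (t.bind σ) (t'.bind σ) :=
  h.lift (fun x => x.bind σ) fun _ _ h => h.bind hL fun _ => .refl _

theorem lift (hL : ∀ t ρ σ, L t ρ → L (t.bind σ) ρ) (h : PReds S L t t') :
    PReds S L t.lift t'.lift := by
  rw [Tm.lift_eq_bind, Tm.lift_eq_bind]
  exact h.bind hL _

theorem eq_of_lamConst (h : PReds S L t t') (ht : t.LamConst) : t' = t := by
  induction h with
  | refl => rfl
  | tail _ h ih =>
    rw [ih] at h
    exact h.eq_of_lamConst ht

theorem neu {n : Nat} (h : PReds S L t t') (ht : Tm.Neu n t) : Tm.Neu n t' := by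
  induction h with
  | refl => exact ht
  | tail _ h ih => exact h.neu ih

theorem prim_app {c : S.C} (hc : IsPrim S c) (h : PReds S L (.app (.const c) t) s) :
    ∃ t', s = .app (.const c) t' ∧ PReds S L t t' := by
  induction h with
  | refl => exact ⟨t, rfl, .refl⟩
  | tail _ h ih =>
    obtain ⟨t', rfl, ht⟩ := ih
    obtain ⟨t'', rfl, ht'⟩ := h.prim_app hc
    exact ⟨t'', rfl, ht.tail ht'⟩

theorem prim_app_app {c : S.C} {a b : Tm S.C} (hc : IsPrim S c)
    (h : PReds S L (.app (.app (.const c) a) b) s) :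
    ∃ a' b', s = .app (.app (.const c) a') b' ∧ PReds S L a a' ∧ PReds S L b b' := by
  induction h with
  | refl => exact ⟨a, b, rfl, .refl, .refl⟩
  | tail _ h ih =>
    obtain ⟨a', b', rfl, ha, hb⟩ := ih
    obtain ⟨a'', b'', rfl, ha', hb'⟩ := h.prim_app_app hc
    exact ⟨a'', b'', rfl, ha.tail ha', hb.tail hb'⟩

end PReds

/-- `t x` for a fresh variable `x`. -/
abbrev _root_.ILM.Tm.ext {C : Type} (t : Tm C) : Tm C := .app t.lift (.var 0)

theorem _root_.ILM.Tm.ext_bind_up {C : Type} (σ : Nat → Tm C) (t : Tm C) :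
    t.ext.bind (Tm.up σ) = (t.bind σ).ext := by
  rw [Tm.ext, Tm.bind, Tm.lift_bind_up]
  rfl

theorem _root_.ILM.Tm.ext_bind_inst {C : Type} (s t : Tm C) :
    t.ext.bind (Tm.inst s) = .app t s := by
  rw [Tm.ext, Tm.bind, Tm.lift_bind_inst]
  rfl

theorem PRed.ext (hL : ∀ t ρ σ, L t ρ → L (t.bind σ) ρ) (h : PRed S L t t') :
    PRed S L t.ext t'.ext :=
  .app (h.lift hL) (.refl _)

theorem PReds.ext (hL : ∀ t ρ σ, L t ρ → L (t.bind σ) ρ) (h : PReds S L t t') :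
    PReds S L t.ext t'.ext :=
  .app (h.lift hL) .refl

/-- `t` reduces to the body of a predicate of type `τ` applied to a term with head variable `n`. -/
def IsBody (S : CanSys B D) (L : Tm S.C → Tm S.C → Prop) : ETy B → Nat → Tm S.C → Prop
  | .omega, _, t => L t S.top
  | .eps, _, t => L t S.bot
  | .base b, n, t => ∃ v, PReds S L t (.app (S.AT b) v) ∧ Tm.Neu n v
  | .o, n, t => ∃ w v, PReds S L t (.app S.LT w) ∧ PReds S L w.ext v ∧ Tm.Neu (n + 1) v
  | .arr τ1 τ2, n, t => IsT1 (.arr τ1 τ2) ∧ ∃ a s, PReds S L t (.app (.app S.XiT a) s) ∧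
      IsBody S L τ1 0 a.ext ∧ IsBody S L τ2 (n + 1) s.ext

/-- Terms recognizably formed by applying a primitive, and the propositional constants. -/
inductive Rigid (S : CanSys B D) : Tm S.C → Prop
  | can {c : Tm S.C} : c ∈ S.TT .o → Rigid S c
  | L (t : Tm S.C) : Rigid S (.app S.LT t)
  | A (b : B) (t : Tm S.C) : Rigid S (.app (S.AT b) t)
  | Xi (t s : Tm S.C) : Rigid S (.app (.app S.XiT t) s)

/-- A version of the relation `≻_α` over `L`, standing for `⇝_{<α}`. -/
inductive Value (S : CanSys B D) (L : Tm S.C → Tm S.C → Prop) : Tm S.C → Tm S.C → Prop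
  | refl {ρ : Tm S.C} (hρ : S.Can ρ) : Value S L ρ ρ
  | fn {τ1 τ2 : ETy B} {ρ t : Tm S.C} (hρ : ρ ∈ S.TT (.arr τ1 τ2))
      (h : ∀ a ∈ S.TT τ1, L (.app t a) (S.F τ1 τ2 ρ a)) : Value S L t ρ
  | L {w r : Tm S.C} (h : PReds S L w.ext r) (hr : Rigid S r) : Value S L (.app S.LT w) S.top
  | A {b : B} {c : Tm S.C} (hc : c ∈ S.TT (.base b)) : Value S L (.app (S.AT b) c) S.top
  | XiTop {a s : Tm S.C} {τ : ETy B} (ha : IsBody S L τ 0 a.ext)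
      (h : ∀ c ∈ S.TT τ, L (.app s c) S.top) : Value S L (.app (.app S.XiT a) s) S.top
  | XiBot {a s : Tm S.C} {τ : ETy B} (ha : IsBody S L τ 0 a.ext) {c : Tm S.C} (hc : c ∈ S.TT τ)
      (h : L (.app s c) S.bot) : Value S L (.app (.app S.XiT a) s) S.bot

/-- The version of `⇝_α` over `L`, standing for `⇝_{<α}`. -/
def Reach (S : CanSys B D) (L : Tm S.C → Tm S.C → Prop) (t ρ : Tm S.C) : Prop :=
  ∃ t', PReds S L t t' ∧ Value S L t' ρ

/-! ### Monotonicity and closure under substitution -/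

theorem IsBody.mono (hL : ∀ t ρ, L t ρ → L' t ρ) {τ : ETy B} {n : Nat} (h : IsBody S L τ n t) :
    IsBody S L' τ n t := by
  induction τ generalizing n t with
  | omega => exact hL _ _ h
  | eps => exact hL _ _ h
  | base b =>
    obtain ⟨v, hv, hn⟩ := h
    exact ⟨v, hv.mono hL, hn⟩
  | o =>
    obtain ⟨w, v, hw, hv, hn⟩ := h
    exact ⟨w, v, hw.mono hL, hv.mono hL, hn⟩
  | arr τ1 τ2 ih1 ih2 =>
    obtain ⟨hT, a, s, h, ha, hs⟩ := h
    exact ⟨hT, a, s, h.mono hL, ih1 ha, ih2 hs⟩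

theorem IsBody.bind (hL : ∀ t ρ σ, L t ρ → L (t.bind σ) ρ) {τ : ETy B} {n m : Nat}
    (h : IsBody S L τ n t) {σ : Nat → Tm S.C} (hσ : Tm.Neu m (σ n)) :
    IsBody S L τ m (t.bind σ) := by
  induction τ generalizing n m t σ with
  | omega => exact hL _ _ _ h
  | eps => exact hL _ _ _ h
  | base b =>
    obtain ⟨v, hv, hn⟩ := h
    exact ⟨_, hv.bind hL σ, hn.bind hσ⟩
  | o =>
    obtain ⟨w, v, hw, hv, hn⟩ := h
    refine ⟨_, _, hw.bind hL σ, ?_, hn.bind (σ := Tm.up σ) hσ.lift⟩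
    rw [← Tm.ext_bind_up]
    exact hv.bind hL _
  | arr τ1 τ2 ih1 ih2 =>
    obtain ⟨hT, a, s, h, ha, hs⟩ := h
    refine ⟨hT, _, _, h.bind hL σ, ?_, ?_⟩
    · rw [← Tm.ext_bind_up]
      exact ih1 ha (.var 0)
    · rw [← Tm.ext_bind_up]
      exact ih2 hs hσ.lift

theorem Rigid.bind (h : Rigid S t) (σ : Nat → Tm S.C) : Rigid S (t.bind σ) := by
  cases h with
  | can h => exact .can (CanSys.mem_bind h σ)
  | L => exact .L _
  | A => exact .A _ _
  | Xi => exact .Xi _ _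

theorem Rigid.pred (h : Rigid S t) (hs : PRed S L t s) : Rigid S s := by
  cases h with
  | can h =>
    rw [hs.eq_of_lamConst (CanSys.lamConst_of_mem (by simp) h)]
    exact .can h
  | L =>
    obtain ⟨_, rfl, _⟩ := hs.prim_app isPrim_L
    exact .L _
  | A b =>
    obtain ⟨_, rfl, _⟩ := hs.prim_app (isPrim_A b)
    exact .A _ _
  | Xi =>
    obtain ⟨_, _, rfl, _, _⟩ := hs.prim_app_app isPrim_Xi
    exact .Xi _ _

theorem Rigid.preds (h : Rigid S t) (hs : PReds S L t s) : Rigid S s := by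
  induction hs with
  | refl => exact h
  | tail _ hs ih => exact ih.pred hs

theorem Rigid.not_neu (h : Rigid S t) (n : Nat) : ¬ Tm.Neu n t := by
  intro hn
  cases h with
  | can h =>
    obtain ⟨c, rfl⟩ := CanSys.mem_o h
    nomatch hn
  | L => nomatch hn
  | A => nomatch hn
  | Xi => nomatch hn

/-- Instances of `t x` for all canonical `x` determine those of `t[σ] x`. -/
theorem exists_bind_app (t : Tm S.C) (σ : Nat → Tm S.C) {τ : ETy B} {a : Tm S.C}
    (ha : a ∈ S.TT τ) : ∃ a0 ∈ S.TT τ, ∃ σ', (Tm.app t a0).bind σ' = .app (t.bind σ) a ∧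
      (a0 = a ∨ τ = .omega) := by
  by_cases hτ : τ = .omega
  · subst hτ
    obtain ⟨N, hN⟩ := t.exists_FV_lt
    refine ⟨.var N, by rw [S.TT_omega]; trivial, fun m => if m < N then σ m else a, ?_, .inr rfl⟩
    rw [Tm.bind]
    congr 1
    · exact hN.bind_congr fun n hn => if_pos hn
    · exact if_neg (lt_irrefl N)
  · refine ⟨a, ha, σ, ?_, .inl rfl⟩
    rw [Tm.bind, (CanSys.lamConst_of_mem hτ ha).bind]

theorem Value.bind (hL : ∀ t ρ σ, L t ρ → L (t.bind σ) ρ) (h : Value S L t s)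
    (σ : Nat → Tm S.C) : Value S L (t.bind σ) s := by
  cases h with
  | refl hρ =>
    rw [hρ.lamConst.bind]
    exact .refl hρ
  | @fn τ1 τ2 _ _ hρ h =>
    refine .fn hρ fun a ha => ?_
    obtain ⟨a0, ha0, σ', he, hor⟩ := exists_bind_app t σ ha
    rw [← he]
    have := hL _ _ σ' (h a0 ha0)
    rcases hor with rfl | rfl
    · exact this
    · rwa [CanSys.F_omega_congr hρ a a0]
  | @L w r h hr =>
    refine .L (w := w.bind σ) ?_ (hr.bind (Tm.up σ))
    rw [← Tm.ext_bind_up]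
    exact h.bind hL _
  | A hc => exact .A (CanSys.mem_bind hc σ)
  | @XiTop a s τ ha h =>
    refine .XiTop (a := a.bind σ) (s := s.bind σ) (τ := τ) ?_ fun c hc => ?_
    · rw [← Tm.ext_bind_up]
      exact ha.bind hL (.var 0)
    · obtain ⟨a0, ha0, σ', he, _⟩ := exists_bind_app s σ hc
      rw [← he]
      exact hL _ _ σ' (h a0 ha0)
  | @XiBot a s τ ha c hc h =>
    refine .XiBot (a := a.bind σ) (s := s.bind σ) (τ := τ) ?_ (CanSys.mem_bind hc σ)
      (hL _ _ σ h)
    rw [← Tm.ext_bind_up]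
    exact ha.bind hL (.var 0)

theorem Reach.bind (hL : ∀ t ρ σ, L t ρ → L (t.bind σ) ρ) (h : Reach S L t s)
    (σ : Nat → Tm S.C) : Reach S L (t.bind σ) s := by
  obtain ⟨t', ht, hv⟩ := h
  exact ⟨_, ht.bind hL σ, hv.bind hL σ⟩

/-- The properties of a single level of the construction. -/
structure Regular (S : CanSys B D) (L : Tm S.C → Tm S.C → Prop) : Prop where
  bind : ∀ t ρ σ, L t ρ → L (t.bind σ) ρ
  neu : ∀ t ρ n, L t ρ → ¬ Tm.Neu n t
  can : ∀ ρ, S.Can ρ → L ρ ρ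

theorem Value.not_neu (hD : ∀ b, Nonempty (D b)) (hL : Regular S L) (h : Value S L t s) (n : Nat) :
    ¬ Tm.Neu n t := by
  intro hn
  cases h with
  | refl hρ => cases hρ.lamConst <;> nomatch hn
  | fn hρ h =>
    obtain ⟨a, ha⟩ := S.nonempty_dom hD (CanSys.isT1_of_mem (by simp) hρ)
    exact hL.neu _ _ n (h a ha) (.app a hn)
  | L h hr => nomatch hn
  | A hc => nomatch hn
  | XiTop ha h => nomatch hn
  | XiBot ha hc h => nomatch hn

theorem Regular.reach (hD : ∀ b, Nonempty (D b)) (hL : Regular S L) : Regular S (Reach S L) where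
  bind _ _ σ h := h.bind hL.bind σ
  neu := by
    rintro t ρ n ⟨t', ht, hv⟩ hn
    exact hv.not_neu hD hL n (ht.neu hn)
  can ρ hρ := ⟨ρ, .refl, .refl hρ⟩

/-- The joint properties of two levels of the construction. -/
structure Compat (S : CanSys B D) (L1 L2 : Tm S.C → Tm S.C → Prop) : Prop where
  pred12 : ∀ t t' ρ, L1 t ρ → PRed S L2 t t' → L1 t' ρ
  pred21 : ∀ t t' ρ, L2 t ρ → PRed S L1 t t' → L2 t' ρ
  unique : ∀ t ρ ρ' τ, τ ≠ .omega → ρ ∈ S.TT τ → ρ' ∈ S.TT τ → L1 t ρ → L2 t ρ' → ρ = ρ'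
  body12 : ∀ t ρ τ n, IsT1 τ → IsBody S L1 τ n t → ρ ∈ S.TT .o → ¬ L2 t ρ
  body21 : ∀ t ρ τ n, IsT1 τ → IsBody S L2 τ n t → ρ ∈ S.TT .o → ¬ L1 t ρ

theorem Compat.symm (h : Compat S L1 L2) : Compat S L2 L1 :=
  ⟨h.pred21, h.pred12, fun t ρ ρ' τ hτ hρ hρ' h1 h2 => (h.unique t ρ' ρ τ hτ hρ' hρ h2 h1).symm,
    h.body21, h.body12⟩

/-! ### Commutation of reductions -/

theorem diamond_app (g1 : Regular S L1) (hc : Compat S L1 L2)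
    (a b : Tm S.C)
    (ih : ∀ u, u.size < a.size + b.size + 1 → ∀ x y, PRed S L1 u x → PRed S L2 u y →
      ∃ d, PRed S L2 x d ∧ PRed S L1 y d)
    {x1 x2 y : Tm S.C} (hx1 : PRed S L1 a x1) (hx2 : PRed S L1 b x2)
    (hy : PRed S L2 (.app a b) y) (g2 : Regular S L2) :
    ∃ d, PRed S L2 (.app x1 x2) d ∧ PRed S L1 y d := by
  cases hy with
  | app h1 h2 =>
    obtain ⟨d1, h1, h1'⟩ := ih a (by omega) _ _ hx1 h1
    obtain ⟨d2, h2, h2'⟩ := ih b (by omega) _ _ hx2 h2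
    exact ⟨_, .app h1 h2, .app h1' h2'⟩
  | @beta u u' _ b' h1 h2 =>
    obtain ⟨d2, h2, h2'⟩ := ih b (by omega) _ _ hx2 h2
    cases hx1 with
    | lam hx1 =>
      obtain ⟨d1, h1, h1'⟩ := ih u (by simp only [Tm.size]; omega) _ _ hx1 h1
      exact ⟨_, .beta h1 h2, h1'.subst0 g1.bind h2'⟩
    | eta hx1 =>
      obtain ⟨d1, h1, h1'⟩ := ih _ (by simp only [Tm.size]; omega) _ _ (hx1.ext g1.bind) h1
      refine ⟨_, ?_, h1'.subst0 g1.bind h2'⟩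
      have := h1.subst0 g2.bind h2
      rwa [Tm.subst0_eq, Tm.ext_bind_inst] at this
  | can h1 hcm hρ h =>
    have := hx1.eq_of_lamConst (CanSys.lamConst_of_mem (by simp) hcm)
    subst this
    exact ⟨_, .can h1 hcm hρ (hc.pred21 _ _ _ h hx2), .refl _⟩

theorem diamond_lam_eta (g1 : Regular S L1) (w : Tm S.C)
    (ih : ∀ u, u.size < w.size + 1 → ∀ x y, PRed S L1 u x → PRed S L2 u y →
      ∃ d, PRed S L2 x d ∧ PRed S L1 y d)
    {x y : Tm S.C} (hx : PRed S L1 w.ext x) (hy : PRed S L2 w y) :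
    ∃ d, PRed S L2 (.lam x) d ∧ PRed S L1 y d := by
  rw [Tm.ext] at hx
  generalize hw : w.lift = w' at hx
  cases hx with
  | app h1 h2 =>
    subst hw
    obtain ⟨x', rfl, hx'⟩ := h1.of_lift g1.bind
    cases h2
    obtain ⟨d, h1, h2⟩ := ih w (by omega) _ _ hx' hy
    exact ⟨d, .eta h1, h2⟩
  | @beta v v1 _ b' h1 h2 =>
    cases h2
    cases w with
    | lam w =>
      rw [Tm.lam_lift, Tm.lam.injEq] at hw
      subst hw
      have := h1.bind g1.bind (σ := Tm.inst (.var 0)) (fun n => .refl _)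
      rw [Tm.bind_up_lift_inst] at this
      exact ih _ (by omega) _ _ (.lam (by rwa [Tm.subst0_eq])) hy
    | _ => cases hw
  | can h1 hcm hρ h => exact absurd (.var 0) (g1.neu _ _ 0 h)

theorem PRed.diamond (g1 : Regular S L1) (g2 : Regular S L2) (hc : Compat S L1 L2) {x y : Tm S.C}
    (hx : PRed S L1 t x) (hy : PRed S L2 t y) : ∃ d, PRed S L2 x d ∧ PRed S L1 y d := by
  induction hN : t.size using Nat.strong_induction_on generalizing t x y with
  | _ N ihN =>
  subst hN
  have ih : ∀ u, u.size < t.size → ∀ x y, PRed S L1 u x → PRed S L2 u y →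
      ∃ d, PRed S L2 x d ∧ PRed S L1 y d := fun u hu x y hx hy => ihN _ hu hx hy rfl
  have ih' : ∀ u, u.size < t.size → ∀ x y, PRed S L2 u x → PRed S L1 u y →
      ∃ d, PRed S L1 x d ∧ PRed S L2 y d := fun u hu x y hx hy =>
    (ih u hu y x hy hx).imp fun _ h => h.symm
  clear ihN
  have swap : ∀ {x y}, (∃ d, PRed S L1 y d ∧ PRed S L2 x d) →
    ∃ d, PRed S L2 x d ∧ PRed S L1 y d := fun h => h.imp fun _ h => h.symm
  cases hx with
  | var => exact ⟨_, hy, .refl _⟩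
  | const => exact ⟨_, hy, .refl _⟩
  | app h1 h2 => exact diamond_app g1 hc _ _ ih h1 h2 hy g2
  | @beta u u' b b' h1 h2 =>
    cases hy with
    | app k1 k2 =>
      exact swap (diamond_app g2 hc.symm _ _ ih' k1 k2 (.beta h1 h2) g1)
    | beta k1 k2 =>
      obtain ⟨d1, e1, f1⟩ := ih u (by simp only [Tm.size]; omega) _ _ h1 k1
      obtain ⟨d2, e2, f2⟩ := ih b (by simp only [Tm.size]; omega) _ _ h2 k2
      exact ⟨_, e1.subst0 g2.bind e2, f1.subst0 g1.bind f2⟩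
    | can _ hcm =>
      exfalso
      rename_i hn _ _ _
      obtain ⟨c, hcc⟩ := S.TT_const _ (CanSys.isT1_of_mem (by simp) hcm)
        (fun _ he => hn (by cases he; rfl)) _ hcm
      cases hcc
  | can h1 hcm hρ h =>
    cases hy with
    | app k1 k2 =>
      exact swap (diamond_app g2 hc.symm _ _ ih' k1 k2 (.can h1 hcm hρ h) g1)
    | beta k1 k2 =>
      exfalso
      obtain ⟨c, hcc⟩ := S.TT_const _ (CanSys.isT1_of_mem (by simp) hcm)
        (fun _ he => h1 (by cases he; rfl)) _ hcm
      cases hcc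
    | can k1 hcm' hρ' k =>
      cases CanSys.mem_unique (by simp) (by simp) hcm hcm'
      rw [hc.unique _ _ _ _ h1 hρ hρ' h k]
      exact ⟨_, .refl _, .refl _⟩
  | lam h1 =>
    cases hy with
    | lam k1 =>
      obtain ⟨d, e, f⟩ := ih _ (by simp only [Tm.size]; omega) _ _ h1 k1
      exact ⟨_, .lam e, .lam f⟩
    | @eta w _ k1 =>
      exact diamond_lam_eta g1 w
        (fun u hu => ih u (by simp only [Tm.size, Tm.lift, Tm.size_rename]; omega)) h1 k1
  | @eta w _ h1 =>
    generalize hy' : Tm.lam (.app w.lift (.var 0)) = z at hy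
    cases hy with
    | @lam z z' k1 =>
      cases hy'
      exact swap (diamond_lam_eta g2 w
        (fun u hu => ih' u (by simp only [Tm.size, Tm.lift, Tm.size_rename]; omega)) k1 h1)
    | @eta w' _ k1 =>
      simp only [Tm.lam.injEq, Tm.app.injEq, and_true] at hy'
      have : w = w' := by
        rw [← Tm.lift_bind_inst (.var 0) w, hy', Tm.lift_bind_inst]
      subst this
      exact ih _ (by simp only [Tm.size, Tm.lift, Tm.size_rename]; omega) _ _ h1 k1
    | _ => cases hy'

theorem PReds.commute (g1 : Regular S L1) (g2 : Regular S L2) (hc : Compat S L1 L2) {x y : Tm S.C}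
    (hx : PReds S L1 t x) (hy : PReds S L2 t y) : ∃ d, PReds S L2 x d ∧ PReds S L1 y d := by
  have strip : ∀ {t x y : Tm S.C}, PReds S L1 t x → PRed S L2 t y →
      ∃ d, PRed S L2 x d ∧ PReds S L1 y d := by
    intro t x y hx hy
    induction hx with
    | refl => exact ⟨y, hy, .refl⟩
    | tail _ h ih =>
      obtain ⟨d, h1, h2⟩ := ih
      obtain ⟨e, h3, h4⟩ := h.diamond g1 g2 hc h1
      exact ⟨e, h3, h2.tail h4⟩
  induction hy with
  | refl => exact ⟨x, .refl, hx⟩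
  | tail _ h ih =>
    obtain ⟨d, h1, h2⟩ := ih
    obtain ⟨e, h3, h4⟩ := strip h2 h
    exact ⟨e, h1.tail h3, h4⟩


/-! ### Preservation and uniqueness of bodies and values -/

theorem IsBody.isTp {τ : ETy B} {n : Nat} (h : IsBody S L τ n t) : IsTp τ := by
  cases τ with
  | o => exact .inl .o
  | base b => exact .inl (.base b)
  | arr => exact .inl h.1
  | omega => exact .inr (.inl rfl)
  | eps => exact .inr (.inr rfl)

theorem Compat.preds12 (hc : Compat S L1 L2) {ρ : Tm S.C} (h : L1 t ρ) (ht : PReds S L2 t t') :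
    L1 t' ρ := by
  induction ht with
  | refl => exact h
  | tail _ ht ih => exact hc.pred12 _ _ _ ih ht

theorem Compat.not_omega_eps (hc : Compat S L1 L2) (h1 : L1 t S.top) (h2 : L2 t S.bot) : False :=
  S.top_ne_bot (hc.unique _ _ _ .o (by simp) S.top_mem S.bot_mem h1 h2)

theorem IsBody.preds (g1 : Regular S L1) (g2 : Regular S L2) (hc : Compat S L1 L2) {τ : ETy B}
    {n : Nat} (h : IsBody S L1 τ n t) (ht : PReds S L2 t t') : IsBody S L1 τ n t' := by
  induction τ generalizing n t t' with
  | omega => exact hc.preds12 h ht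
  | eps => exact hc.preds12 h ht
  | base b =>
    obtain ⟨v, hv, hn⟩ := h
    obtain ⟨d, h1, h2⟩ := PReds.commute g1 g2 hc hv ht
    obtain ⟨v', rfl, hv'⟩ := h1.prim_app (isPrim_A b)
    exact ⟨v', h2, hv'.neu hn⟩
  | o =>
    obtain ⟨w, v, hw, hv, hn⟩ := h
    obtain ⟨d, h1, h2⟩ := PReds.commute g1 g2 hc hw ht
    obtain ⟨w', rfl, hw'⟩ := h1.prim_app isPrim_L
    obtain ⟨e, h3, h4⟩ := PReds.commute g1 g2 hc hv (hw'.ext g2.bind)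
    exact ⟨w', e, h2, h4, h3.neu hn⟩
  | arr τ1 τ2 ih1 ih2 =>
    obtain ⟨hT, a, s, h, ha, hs⟩ := h
    obtain ⟨d, h1, h2⟩ := PReds.commute g1 g2 hc h ht
    obtain ⟨a', s', rfl, ha', hs'⟩ := h1.prim_app_app isPrim_Xi
    exact ⟨hT, a', s', h2, ih1 ha (ha'.ext g2.bind), ih2 hs (hs'.ext g2.bind)⟩

/-- The term `t` starts with the constant deciding the outermost shape of `τ`. -/
def Headed (S : CanSys B D) : ETy B → Tm S.C → Prop
  | .base b, t => ∃ v, t = .app (S.AT b) v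
  | .o, t => ∃ w, t = .app S.LT w
  | .arr _ _, t => ∃ a s, t = .app (.app S.XiT a) s
  | _, _ => False

theorem Headed.preds {τ : ETy B} (h : Headed S τ t) (ht : PReds S L t t') : Headed S τ t' := by
  cases τ with
  | base b =>
    obtain ⟨v, rfl⟩ := h
    obtain ⟨v', rfl, _⟩ := ht.prim_app (isPrim_A b)
    exact ⟨_, rfl⟩
  | o =>
    obtain ⟨v, rfl⟩ := h
    obtain ⟨v', rfl, _⟩ := ht.prim_app isPrim_L
    exact ⟨_, rfl⟩
  | arr =>
    obtain ⟨a, s, rfl⟩ := h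
    obtain ⟨a', s', rfl, _⟩ := ht.prim_app_app isPrim_Xi
    exact ⟨_, _, rfl⟩
  | omega => exact h
  | eps => exact h

theorem IsBody.headed {τ : ETy B} {n : Nat} (hτ : IsT1 τ) (h : IsBody S L τ n t) :
    ∃ r, PReds S L t r ∧ Headed S τ r := by
  cases hτ with
  | o =>
    obtain ⟨w, v, hw, _⟩ := h
    exact ⟨_, hw, _, rfl⟩
  | base b =>
    obtain ⟨v, hv, _⟩ := h
    exact ⟨_, hv, _, rfl⟩
  | _ =>
    obtain ⟨_, a, s, h, _⟩ := h
    exact ⟨_, h, _, _, rfl⟩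

theorem Headed.unique {τ τ' : ETy B} (h : Headed S τ t) (h' : Headed S τ' t) :
    τ = τ' ∨ ∃ τ1 τ2 τ1' τ2', τ = .arr τ1 τ2 ∧ τ' = .arr τ1' τ2' := by
  have hLA := S.hLA
  cases τ <;> cases τ' <;> simp only [Headed] at h h' <;>
    first
    | exact .inl rfl
    | exact .inr ⟨_, _, _, _, rfl, rfl⟩
    | (obtain ⟨_, rfl⟩ := h
       obtain ⟨_, he⟩ := h'
       simp [CanSys.AT, CanSys.LT, S.hAinj.eq_iff, hLA, (hLA _).symm] at he
       try exact .inl (by rw [he.1]))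
    | (obtain ⟨_, _, rfl⟩ := h
       obtain ⟨_, he⟩ := h'
       simp [CanSys.AT, CanSys.LT] at he)

theorem IsBody.shape (g1 : Regular S L1) (g2 : Regular S L2) (hc : Compat S L1 L2) {τ τ' : ETy B}
    {n n' : Nat} (hτ : IsT1 τ) (h1 : IsBody S L1 τ n t) (h2 : IsBody S L2 τ' n' t) :
    τ = τ' ∨ ∃ τ1 τ2 τ1' τ2', τ = .arr τ1 τ2 ∧ τ' = .arr τ1' τ2' := by
  rcases h2.isTp with h | rfl | rfl
  · obtain ⟨r1, k1, e1⟩ := h1.headed hτ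
    obtain ⟨r2, k2, e2⟩ := h2.headed h
    obtain ⟨d, f1, f2⟩ := PReds.commute g1 g2 hc k1 k2
    exact (e1.preds f1).unique (e2.preds f2)
  · exact (hc.body12 _ _ _ _ hτ h1 S.top_mem h2).elim
  · exact (hc.body12 _ _ _ _ hτ h1 S.bot_mem h2).elim

theorem IsBody.unique (g1 : Regular S L1) (g2 : Regular S L2) (hc : Compat S L1 L2) {τ τ' : ETy B}
    {n n' : Nat} (h1 : IsBody S L1 τ n t) (h2 : IsBody S L2 τ' n' t) : τ = τ' := by
  induction τ generalizing τ' n n' t with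
  | omega =>
    rcases h2.isTp with h | rfl | rfl
    · exact (hc.body21 _ _ _ _ h h2 S.top_mem h1).elim
    · rfl
    · exact (hc.not_omega_eps h1 h2).elim
  | eps =>
    rcases h2.isTp with h | rfl | rfl
    · exact (hc.body21 _ _ _ _ h h2 S.bot_mem h1).elim
    · exact (hc.symm.not_omega_eps h2 h1).elim
    · rfl
  | arr τ1 τ2 ih1 ih2 =>
    rcases h1.shape g1 g2 hc h1.1 h2 with he | ⟨_, _, τ1', τ2', he, rfl⟩
    · exact he
    · obtain ⟨_, a1, s1, k1, ha1, hs1⟩ := h1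
      obtain ⟨_, a2, s2, k2, ha2, hs2⟩ := h2
      obtain ⟨d, f1, f2⟩ := PReds.commute g1 g2 hc k1 k2
      obtain ⟨a', s', rfl, l1, l2⟩ := f1.prim_app_app isPrim_Xi
      obtain ⟨a'', s'', he, l1', l2'⟩ := f2.prim_app_app isPrim_Xi
      cases he
      rw [ih1 (ha1.preds g1 g2 hc (l1.ext g2.bind)) (ha2.preds g2 g1 hc.symm (l1'.ext g1.bind)),
        ih2 (hs1.preds g1 g2 hc (l2.ext g2.bind)) (hs2.preds g2 g1 hc.symm (l2'.ext g1.bind))]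
  | o =>
    rcases h1.shape g1 g2 hc .o h2 with he | ⟨_, _, _, _, he, _⟩
    · exact he
    · cases he
  | base b =>
    rcases h1.shape g1 g2 hc (.base b) h2 with he | ⟨_, _, _, _, he, _⟩
    · exact he
    · cases he

theorem Value.preds (g1 : Regular S L1) (g2 : Regular S L2) (hc : Compat S L1 L2) {ρ : Tm S.C}
    (h : Value S L1 t ρ) (ht : PReds S L2 t t') : Value S L1 t' ρ := by
  cases h with
  | refl hρ =>
    rw [ht.eq_of_lamConst hρ.lamConst]
    exact .refl hρ
  | fn hρ h => exact .fn hρ fun a ha => hc.preds12 (h a ha) (ht.app .refl)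
  | L h hr =>
    obtain ⟨w', rfl, hw⟩ := ht.prim_app isPrim_L
    obtain ⟨e, h3, h4⟩ := PReds.commute g1 g2 hc h (hw.ext g2.bind)
    exact .L h4 (hr.preds h3)
  | A hm =>
    obtain ⟨c', rfl, h⟩ := ht.prim_app (isPrim_A _)
    rw [h.eq_of_lamConst (CanSys.lamConst_of_mem (by simp) hm)]
    exact .A hm
  | XiTop ha h =>
    obtain ⟨a', s', rfl, l1, l2⟩ := ht.prim_app_app isPrim_Xi
    exact .XiTop (ha.preds g1 g2 hc (l1.ext g2.bind)) fun c hm =>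
      hc.preds12 (h c hm) (l2.app .refl)
  | XiBot ha hm h =>
    obtain ⟨a', s', rfl, l1, l2⟩ := ht.prim_app_app isPrim_Xi
    exact .XiBot (ha.preds g1 g2 hc (l1.ext g2.bind)) hm (hc.preds12 h (l2.app .refl))

theorem Reach.preds (g1 : Regular S L1) (g2 : Regular S L2) (hc : Compat S L1 L2) {ρ : Tm S.C}
    (h : Reach S L1 t ρ) (ht : PReds S L2 t t') : Reach S L1 t' ρ := by
  obtain ⟨u, hu, hv⟩ := h
  obtain ⟨d, h1, h2⟩ := PReds.commute g1 g2 hc hu ht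
  exact ⟨d, h2, hv.preds g1 g2 hc h1⟩

theorem Value.not_body (hD : ∀ b, Nonempty (D b)) (g1 : Regular S L1) (g2 : Regular S L2)
    (hc : Compat S L1 L2) {τ : ETy B} (hτ : IsT1 τ) {n : Nat} {ρ : Tm S.C}
    (h1 : IsBody S L1 τ n t) (hρ : ρ ∈ S.TT .o) (h2 : Value S L2 t ρ) : False := by
  obtain ⟨r, hr, hh⟩ := h1.headed hτ
  have arr : ∀ {a s : Tm S.C} {τ0 : ETy B}, IsBody S L1 τ n (.app (.app S.XiT a) s) →
      IsBody S L2 τ0 0 a.ext → (∀ c ∈ S.TT τ0, L2 (.app s c) ρ → False) ∧ (S.TT τ0).Nonempty := by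
    intro a s τ0 h1 ha
    obtain ⟨r, hr, hh⟩ := h1.headed hτ
    have hh' : Headed S (.arr τ0 .o) r := Headed.preds ⟨a, s, rfl⟩ hr
    obtain ⟨τ1, τ2, rfl⟩ : ∃ τ1 τ2, τ = .arr τ1 τ2 := by
      rcases hh.unique hh' with he | ⟨τ1, τ2, _, _, he, _⟩ <;> exact ⟨_, _, he⟩
    obtain ⟨_, a', s', k, ha', hs'⟩ := h1
    obtain ⟨_, _, he, l1, l2⟩ := k.prim_app_app isPrim_Xi
    cases he
    obtain rfl := ha'.unique g1 g2 hc (ha.preds g2 g1 hc.symm (l1.ext g1.bind))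
    refine ⟨fun c hm h => ?_, S.nonempty_dom hD hτ⟩
    have hs := hs'.bind g1.bind (σ := Tm.inst c) (m := n) (.var n)
    rw [Tm.ext_bind_inst] at hs
    exact hc.body12 _ _ _ _ hτ.cod hs hρ (hc.symm.preds12 h (l2.app .refl))
  cases h2 with
  | refl hm =>
    obtain ⟨c, rfl⟩ := CanSys.mem_o hρ
    rw [hr.eq_of_lamConst hm.lamConst] at hh
    cases τ <;> simp [Headed] at hh
  | fn hm h => cases CanSys.mem_unique (by simp) (by simp) hρ hm
  | @L w r' h hr' =>
    have hh' : Headed S .o r := Headed.preds ⟨w, rfl⟩ hr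
    rcases hh.unique hh' with rfl | ⟨_, _, _, _, _, he⟩
    · obtain ⟨w', v, hw, hv, hn⟩ := h1
      obtain ⟨_, he, hw⟩ := hw.prim_app isPrim_L
      cases he
      obtain ⟨d, f1, f2⟩ := PReds.commute g1 g2 hc ((hw.ext g1.bind).trans hv) h
      exact (hr'.preds f2).not_neu _ (f1.neu hn)
    · cases he
  | @A b c hm =>
    have hh' : Headed S (.base b) r := Headed.preds ⟨c, rfl⟩ hr
    rcases hh.unique hh' with rfl | ⟨_, _, _, _, _, he⟩
    · obtain ⟨v, hv, hn⟩ := h1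
      obtain ⟨_, he, hw⟩ := hv.prim_app (isPrim_A b)
      cases he
      rw [hw.eq_of_lamConst (CanSys.lamConst_of_mem (by simp) hm)] at hn
      obtain ⟨d, rfl⟩ := S.TT_const _ (.base b) (by simp) _ hm
      nomatch hn
    · cases he
  | XiTop ha h =>
    obtain ⟨k, c, hm⟩ := arr h1 ha
    exact k c hm (h c hm)
  | XiBot ha hm h => exact (arr h1 ha).1 _ hm h

theorem Reach.not_body (hD : ∀ b, Nonempty (D b)) (g1 : Regular S L1) (g2 : Regular S L2)
    (hc : Compat S L1 L2) {τ : ETy B} (hτ : IsT1 τ) {n : Nat} {ρ : Tm S.C}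
    (h1 : IsBody S L1 τ n t) (hρ : ρ ∈ S.TT .o) (h2 : Reach S L2 t ρ) : False := by
  obtain ⟨t', ht, hv⟩ := h2
  exact hv.not_body hD g1 g2 hc hτ (h1.preds g1 g2 hc ht) hρ

/-- Canonical terms of function types reach their values. -/
theorem Regular.app_can (g : Regular S L) {τ1 τ2 : ETy B} {ρ a : Tm S.C}
    (hρ : ρ ∈ S.TT (.arr τ1 τ2)) (ha : a ∈ S.TT τ1) :
    PRed S L (.app ρ a) (S.F τ1 τ2 ρ a) := by
  by_cases hom : τ1 = .omega
  · subst hom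
    have hT := (CanSys.isT1_of_mem (by simp) hρ).cod
    rw [S.TT_omega_arr τ2 hT] at hρ
    obtain ⟨r, hr, rfl⟩ := hρ
    rw [S.F_omega _ _ hr]
    have := PRed.beta (.refl r : PRed S L r r) (.refl a)
    rwa [Tm.subst0_eq, (CanSys.lamConst_of_mem hT.ne_omega hr).bind] at this
  · exact .can hom hρ ha (g.can _ ⟨_, hom, ha⟩)

theorem Value.unique_refl (g1 : Regular S L1) (hc : Compat S L1 L2)
    {τ : ETy B} (hτ : τ ≠ .omega) {ρ ρ' : Tm S.C} (hρ : ρ ∈ S.TT τ) (hρ' : ρ' ∈ S.TT τ)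
    (h2 : Value S L2 ρ ρ') : ρ = ρ' := by
  cases h2 with
  | refl => rfl
  | @fn τ1 τ2 _ _ hm h =>
    obtain rfl := CanSys.mem_unique hτ (by simp) hρ' hm
    refine CanSys.ext_of_F hρ hρ' fun a ha => ?_
    have hT := (CanSys.isT1_of_mem (by simp) hρ).cod.ne_omega
    exact hc.unique _ _ _ τ2 hT (CanSys.F_mem hρ ha) (CanSys.F_mem hρ' ha)
      (g1.can _ ⟨τ2, hT, CanSys.F_mem hρ ha⟩)
      (hc.symm.pred12 _ _ _ (h a ha) (g1.app_can hρ ha))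
  | _ => nomatch CanSys.lamConst_of_mem hτ hρ

theorem Value.unique_of_Xi (g1 : Regular S L1) (g2 : Regular S L2) (hc : Compat S L1 L2)
    {a s : Tm S.C} {τ τ' : ETy B} (ha : IsBody S L1 τ 0 a.ext)
    (h : ∀ c ∈ S.TT τ, L1 (.app s c) S.top) (ha' : IsBody S L2 τ' 0 a.ext) {c : Tm S.C}
    (hm : c ∈ S.TT τ') (h' : L2 (.app s c) S.bot) : False := by
  obtain rfl := ha.unique g1 g2 hc ha'
  exact hc.not_omega_eps (h c hm) h'

theorem Value.eq_top {c : S.C} {ρ : Tm S.C} (h : Value S L (.app (.const c) t) ρ)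
    (hρ : ρ ∈ S.TT .o) : ρ = S.top := by
  generalize hu : Tm.app (.const c) t = u at h
  cases h with
  | refl hm =>
    subst hu
    nomatch hm.lamConst
  | fn hm => cases CanSys.mem_unique (by simp) (by simp) hρ hm
  | XiBot => cases hu
  | _ => rfl

theorem Value.unique (g1 : Regular S L1) (g2 : Regular S L2) (hc : Compat S L1 L2)
    {τ : ETy B} (hτ : τ ≠ .omega) {ρ ρ' : Tm S.C} (hρ : ρ ∈ S.TT τ) (hρ' : ρ' ∈ S.TT τ)
    (h1 : Value S L1 t ρ) (h2 : Value S L2 t ρ') : ρ = ρ' := by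
  cases h1 with
  | refl _ => exact h2.unique_refl g1 hc hτ hρ hρ'
  | @fn τ1 τ2 _ _ hm h =>
    obtain rfl := CanSys.mem_unique hτ (by simp) hρ hm
    cases h2 with
    | refl _ => exact (Value.unique_refl g2 hc.symm hτ hρ' hρ (.fn hm h)).symm
    | @fn τ1' τ2' _ _ hm' h' =>
      cases CanSys.mem_unique hτ (by simp) hρ' hm'
      refine CanSys.ext_of_F hρ hρ' fun a ha => ?_
      exact hc.unique _ _ _ τ2 (CanSys.isT1_of_mem (by simp) hρ).cod.ne_omega
        (CanSys.F_mem hρ ha) (CanSys.F_mem hρ' ha) (h a ha) (h' a ha)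
    | XiBot => cases CanSys.mem_unique (by simp) (by simp) hρ' S.bot_mem
    | _ => cases CanSys.mem_unique (by simp) (by simp) hρ' S.top_mem
  | XiTop ha h =>
    cases h2 with
    | refl hm => nomatch hm.lamConst
    | fn hm =>
      obtain rfl := CanSys.mem_unique hτ (by simp) hρ S.top_mem
      cases CanSys.mem_unique (by simp) (by simp) hρ' hm
    | XiTop => rfl
    | XiBot ha' hm' h' => exact (Value.unique_of_Xi g1 g2 hc ha h ha' hm' h').elim
  | XiBot ha hm h =>
    cases h2 with
    | refl hm => nomatch hm.lamConst
    | fn hm =>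
      obtain rfl := CanSys.mem_unique hτ (by simp) hρ S.bot_mem
      cases CanSys.mem_unique (by simp) (by simp) hρ' hm
    | XiTop ha' h' => exact (Value.unique_of_Xi g2 g1 hc.symm ha' h' ha hm h).elim
    | XiBot => rfl
  | _ =>
    obtain rfl := CanSys.mem_unique hτ (by simp) hρ S.top_mem
    exact (h2.eq_top hρ').symm

theorem Reach.unique (g1 : Regular S L1) (g2 : Regular S L2) (hc : Compat S L1 L2)
    {τ : ETy B} (hτ : τ ≠ .omega) {ρ ρ' : Tm S.C} (hρ : ρ ∈ S.TT τ) (hρ' : ρ' ∈ S.TT τ)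
    (h1 : Reach S L1 t ρ) (h2 : Reach S L2 t ρ') : ρ = ρ' := by
  obtain ⟨u, hu, hv⟩ := h1
  obtain ⟨u', hu', hv'⟩ := h2
  obtain ⟨d, f1, f2⟩ := PReds.commute g1 g2 hc hu hu'
  exact (hv.preds g1 g2 hc f1).unique g1 g2 hc hτ hρ hρ' (hv'.preds g2 g1 hc.symm f2)

/-! ### The levels -/

/-- The level `α`, standing for `⇝_{<α}` together with the identity on canonical terms. -/
def lev (S : CanSys B D) (α : Ordinal.{0}) (t ρ : Tm S.C) : Prop :=
  (t = ρ ∧ S.Can ρ) ∨ ∃ γ, ∃ _ : γ < α, Reach S (lev S γ) t ρ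
termination_by α

/-- The part of the level `α` not given by the identity. -/
def levLt (S : CanSys B D) (α : Ordinal.{0}) (t ρ : Tm S.C) : Prop :=
  ∃ γ, γ < α ∧ Reach S (lev S γ) t ρ

theorem lev_iff {α : Ordinal.{0}} {ρ : Tm S.C} :
    lev S α t ρ ↔ (t = ρ ∧ S.Can ρ) ∨ levLt S α t ρ := by
  rw [lev]
  simp only [levLt, exists_prop]

theorem lev_regular (hD : ∀ b, Nonempty (D b)) (α : Ordinal.{0}) : Regular S (lev S α) := by
  induction α using WellFoundedLT.induction with
  | _ α ih =>
  refine ⟨fun t ρ σ h => ?_, fun t ρ n h hn => ?_, fun ρ hρ => lev_iff.mpr (.inl ⟨rfl, hρ⟩)⟩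
  · rw [lev_iff] at h ⊢
    rcases h with ⟨rfl, hρ⟩ | ⟨γ, hγ, h⟩
    · exact .inl ⟨hρ.lamConst.bind σ, hρ⟩
    · exact .inr ⟨γ, hγ, h.bind (ih γ hγ).bind σ⟩
  · rw [lev_iff] at h
    rcases h with ⟨rfl, hρ⟩ | ⟨γ, hγ, h⟩
    · cases hρ.lamConst <;> nomatch hn
    · exact ((ih γ hγ).reach hD).neu _ _ _ h hn

theorem lev_mono {α β : Ordinal.{0}} (hαβ : α ≤ β) (t ρ : Tm S.C) (h : lev S α t ρ) :
    lev S β t ρ := by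
  rw [lev_iff] at h ⊢
  exact h.imp id fun ⟨γ, hγ, h⟩ => ⟨γ, hγ.trans_le hαβ, h⟩

theorem not_isBody_of_can {τ : ETy B} (hτ : IsT1 τ) {n : Nat} {ρ : Tm S.C} (hρ : S.Can ρ) :
    ¬ IsBody S L τ n ρ := by
  intro h
  obtain ⟨r, hr, hh⟩ := h.headed hτ
  rw [hr.eq_of_lamConst hρ.lamConst] at hh
  have := hρ.lamConst
  cases τ <;> simp only [Headed] at hh
  · obtain ⟨_, rfl⟩ := hh; nomatch this
  · obtain ⟨_, rfl⟩ := hh; nomatch this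
  · obtain ⟨_, _, rfl⟩ := hh; nomatch this

theorem lev_compat (hD : ∀ b, Nonempty (D b)) (α β : Ordinal.{0}) :
    Compat S (lev S α) (lev S β) := by
  induction α using WellFoundedLT.induction generalizing β with
  | _ α ihα =>
  induction β using WellFoundedLT.induction with
  | _ β ihβ =>
  have g : ∀ α, Regular S (lev S α) := lev_regular hD
  refine ⟨?_, ?_, ?_, ?_, ?_⟩
  · intro t t' ρ h ht
    rw [lev_iff] at h ⊢
    rcases h with ⟨rfl, hρ⟩ | ⟨γ, hγ, h⟩
    · exact .inl ⟨ht.eq_of_lamConst hρ.lamConst, hρ⟩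
    · exact .inr ⟨γ, hγ, h.preds (g _) (g _) (ihα γ hγ β) (.single ht)⟩
  · intro t t' ρ h ht
    rw [lev_iff] at h ⊢
    rcases h with ⟨rfl, hρ⟩ | ⟨γ, hγ, h⟩
    · exact .inl ⟨ht.eq_of_lamConst hρ.lamConst, hρ⟩
    · exact .inr ⟨γ, hγ, h.preds (g _) (g _) (ihβ γ hγ).symm (.single ht)⟩
  · intro t ρ ρ' τ hτ hρ hρ' h h'
    rw [lev_iff] at h h'
    rcases h with ⟨rfl, hm⟩ | ⟨γ, hγ, h⟩ <;> rcases h' with ⟨rfl, hm'⟩ | ⟨δ, hδ, h'⟩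
    · rfl
    · exact Reach.unique (g α) (g δ) (ihβ δ hδ) hτ hρ hρ' ⟨_, .refl, .refl hm⟩ h'
    · exact h.unique (g γ) (g β) (ihα γ hγ β) hτ hρ hρ' ⟨_, .refl, .refl hm'⟩
    · exact h.unique (g γ) (g δ) (ihα γ hγ δ) hτ hρ hρ' h'
  · intro t ρ τ n hτ h hρ h'
    rw [lev_iff] at h'
    rcases h' with ⟨rfl, hm⟩ | ⟨δ, hδ, h'⟩
    · exact not_isBody_of_can hτ hm h
    · exact h'.not_body hD (g α) (g δ) (ihβ δ hδ) hτ h hρ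
  · intro t ρ τ n hτ h hρ h'
    rw [lev_iff] at h'
    rcases h' with ⟨rfl, hm⟩ | ⟨γ, hγ, h'⟩
    · exact not_isBody_of_can hτ hm h
    · exact h'.not_body hD (g β) (g γ) (ihα γ hγ β).symm hτ h hρ

/-! ### Closure under expansion -/

/-- The levels are closed under expansion by β- and η-reduction. -/
def ExpClosed (S : CanSys B D) (L : Tm S.C → Tm S.C → Prop) : Prop :=
  ∀ t t' ρ, PRed S (fun _ _ => False) t t' → L t' ρ → L t ρ

theorem IsBody.expand (hL : ExpClosed S L) {τ : ETy B} {n : Nat}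
    (ht : PRed S (fun _ _ => False) t t') (h : IsBody S L τ n t') : IsBody S L τ n t := by
  have ht' : PRed S L t t' := ht.mono fun _ _ h => h.elim
  cases τ with
  | omega => exact hL _ _ _ ht h
  | eps => exact hL _ _ _ ht h
  | base b =>
    obtain ⟨v, hv, hn⟩ := h
    exact ⟨v, hv.head ht', hn⟩
  | o =>
    obtain ⟨w, v, hw, hv, hn⟩ := h
    exact ⟨w, v, hw.head ht', hv, hn⟩
  | arr =>
    obtain ⟨hT, a, s, h, hs⟩ := h
    exact ⟨hT, a, s, h.head ht', hs⟩

theorem levLt_le_lev {α : Ordinal.{0}} (t ρ : Tm S.C) (h : levLt S α t ρ) : lev S α t ρ :=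
  lev_iff.mpr (.inr h)

theorem levLt_mono {α β : Ordinal.{0}} (hαβ : α ≤ β) (t ρ : Tm S.C) (h : levLt S α t ρ) :
    levLt S β t ρ := by
  obtain ⟨γ, hγ, h⟩ := h
  exact ⟨γ, hγ.trans_le hαβ, h⟩

theorem levLt_bind (hD : ∀ b, Nonempty (D b)) {α : Ordinal.{0}} (t ρ : Tm S.C)
    (σ : Nat → Tm S.C) (h : levLt S α t ρ) : levLt S α (t.bind σ) ρ := by
  obtain ⟨γ, hγ, h⟩ := h
  exact ⟨γ, hγ, h.bind (lev_regular hD γ).bind σ⟩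

theorem levLt_expClosed (α : Ordinal.{0}) : ExpClosed S (levLt S α) := by
  rintro t t' ρ ht ⟨γ, hγ, u, hu, hv⟩
  exact ⟨γ, hγ, u, hu.head (ht.mono fun _ _ h => h.elim), hv⟩

/-- The body of an abstraction, and `t x` for other terms `t`. -/
def _root_.ILM.Tm.body {C : Type} : Tm C → Tm C
  | .lam b => b
  | t => t.ext

theorem PRed.beta_lift (b : Tm S.C) : PRed S L (Tm.lam b).ext b := by
  have := PRed.beta (L := L) (.refl (b.bind (Tm.up fun n => .var (n + 1)))) (.refl (.var 0))
  rwa [Tm.subst0_eq, Tm.bind_up_lift_inst, ← Tm.lam_lift] at this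

theorem PRed.ext_body (t : Tm S.C) : PRed S L t.ext t.body := by
  cases t with
  | lam b => exact PRed.beta_lift b
  | _ => exact .refl _

theorem PRed.beta_inst (b s : Tm S.C) : PRed S L (.app (.lam b) s) (b.bind (Tm.inst s)) := by
  rw [← Tm.subst0_eq]
  exact .beta (.refl _) (.refl _)

/-- The substitution replacing the variable `0` by `f x`. -/
def composeSubst (C : Type) : Nat → Tm C
  | 0 => .app (.var 1) (.var 0)
  | m + 1 => .var (m + 2)

theorem CanSys.Ft_eq (t1 t2 : Tm S.C) : S.Ft t1 t2 =
    .lam (.app (.app S.XiT t1.lift) (.lam (t2.body.bind (composeSubst S.C)))) := by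
  have key : ∀ t : Tm S.C, t.ext.bind (composeSubst S.C) =
      .app t.lift.lift (.app (.var 1) (.var 0)) := by
    intro t
    rw [Tm.ext, Tm.bind]
    congr 1
    rw [Tm.lift_bind, Tm.lift_eq_bind t.lift, Tm.lift_bind]
    rfl
  cases t2 with
  | lam b =>
    unfold CanSys.Ft
    simp only [Tm.body]
    congr 3
  | _ =>
    unfold CanSys.Ft
    simp only [Tm.body]
    rw [key]

theorem IsBody.ext_of_body {α : Ordinal.{0}} {τ : ETy B} {n : Nat}
    (h : IsBody S (levLt S α) τ n t.body) : IsBody S (levLt S α) τ n t.ext :=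
  h.expand (levLt_expClosed α) (PRed.ext_body t)

theorem Value.rigid {ρ : Tm S.C} (h : Value S L t ρ) (hρ : ρ ∈ S.TT .o) : Rigid S t := by
  cases h with
  | refl => exact .can hρ
  | fn hm => cases CanSys.mem_unique (by simp) (by simp) hρ hm
  | L => exact .L _
  | A => exact .A _ _
  | XiTop => exact .Xi _ _
  | XiBot => exact .Xi _ _

theorem Value.L_of_body {w : Tm S.C} (h : Rigid S w.body) : Value S L (.app S.LT w) S.top :=
  .L (.single (PRed.ext_body w)) h

theorem Rigid.lift (h : Rigid S t) : Rigid S t.lift := by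
  rw [Tm.lift_eq_bind]
  exact h.bind _

theorem Value.H_of_rigid (h : Rigid S t) : Value S L (S.Ht t) S.top :=
  .L_of_body (w := S.Kt t) h.lift

theorem Value.L_Ft (t1 t2 : Tm S.C) : Value S L (.app S.LT (S.Ft t1 t2)) S.top := by
  rw [CanSys.Ft_eq]
  exact .L_of_body (.Xi _ _)

section Function

variable {α : Ordinal.{0}} {t1 t2 : Tm S.C} {τ τ1 τ2 : ETy B}

theorem IsBody.lift_ext (hD : ∀ b, Nonempty (D b)) (h1 : IsBody S (levLt S α) τ1 0 t1.body) :
    IsBody S (levLt S α) τ1 0 t1.lift.ext := by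
  have := h1.ext_of_body.bind (fun t ρ σ => levLt_bind hD t ρ σ) (m := 0)
    (σ := Tm.up fun n => .var (n + 1)) (.var 0)
  rwa [Tm.ext_bind_up, ← Tm.lift_eq_bind] at this

/-- The terms `F t₁ t₂` with `t₁` of type `ε`. -/
theorem levLt_Ft_eps (hD : ∀ b, Nonempty (D b)) {β : Ordinal.{0}} (hαβ : α < β)
    (h1 : IsBody S (levLt S α) .eps 0 t1.body) : levLt S β (S.Ft t1 t2).body S.top := by
  rw [CanSys.Ft_eq]
  refine ⟨α, hαβ, _, .refl, .XiTop ((h1.lift_ext hD).mono levLt_le_lev) fun c hc => ?_⟩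
  rw [S.TT_eps] at hc
  exact hc.elim

/-- The function space body. -/
theorem IsBody.Ft (hD : ∀ b, Nonempty (D b)) {β : Ordinal.{0}} (hαβ : α < β) (hτ1 : IsTp τ1)
    (hτ2 : IsTp τ2) (h1 : IsBody S (levLt S α) τ1 0 t1.body)
    (h2 : IsBody S (levLt S α) τ2 0 t2.body) :
    IsTp (arrN τ1 τ2) ∧ IsBody S (levLt S β) (arrN τ1 τ2) 0 (S.Ft t1 t2).body := by
  have hL : ∀ t ρ σ, levLt S α t ρ → levLt S α (t.bind σ) ρ := fun t ρ σ => levLt_bind hD t ρ σ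
  have inst : ∀ c ρ, levLt S α t2.body ρ →
      lev S α (.app (.lam (t2.body.bind (composeSubst S.C))) c) ρ := fun c ρ h =>
    levLt_le_lev _ _ (levLt_expClosed α _ _ _ (PRed.beta_inst _ c) (hL _ _ _ (hL _ _ _ h)))
  have ha := (h1.lift_ext hD).mono levLt_le_lev
  rcases hτ2 with hτ2 | rfl | rfl
  · have arr : IsT1 (.arr τ1 τ2) → IsBody S (levLt S β) (.arr τ1 τ2) 0 (S.Ft t1 t2).body := by
      intro hT
      rw [CanSys.Ft_eq]
      refine ⟨hT, _, _, .refl, (h1.lift_ext hD).mono (levLt_mono hαβ.le), ?_⟩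
      refine IsBody.expand (levLt_expClosed β) (PRed.beta_lift _) ?_
      exact (h2.bind hL (m := 1) (.app _ (.var 1))).mono (levLt_mono hαβ.le)
    rcases hτ1 with hτ1 | rfl | rfl
    · have he : arrN τ1 τ2 = .arr τ1 τ2 := by cases hτ1 <;> cases hτ2 <;> rfl
      rw [he]
      exact ⟨.inl (.arr hτ1 hτ2), arr (.arr hτ1 hτ2)⟩
    · have he : arrN .omega τ2 = .arr .omega τ2 := by cases hτ2 <;> rfl
      rw [he]
      exact ⟨.inl (.omegaArr hτ2), arr (.omegaArr hτ2)⟩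
    · have he : arrN .eps τ2 = .omega := by cases hτ2 <;> rfl
      rw [he]
      exact ⟨.inr (.inl rfl), levLt_Ft_eps hD hαβ h1⟩
  · have he : arrN τ1 .omega = .omega := by cases τ1 <;> rfl
    rw [he, CanSys.Ft_eq]
    exact ⟨.inr (.inl rfl), α, hαβ, _, .refl, .XiTop ha fun c _ => inst c _ h2⟩
  · by_cases hε : τ1 = .eps
    · subst hε
      exact ⟨.inr (.inl rfl), levLt_Ft_eps hD hαβ h1⟩
    · have he : arrN τ1 .eps = .eps := by cases τ1 <;> first | rfl | exact absurd rfl hε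
      have ⟨c, hc⟩ : (S.TT τ1).Nonempty := by
        rcases hτ1 with hτ1 | rfl | rfl
        · exact S.nonempty_of_isT1 hD hτ1
        · rw [S.TT_omega]
          exact ⟨S.top, trivial⟩
        · exact absurd rfl hε
      rw [he, CanSys.Ft_eq]
      exact ⟨.inr (.inr rfl), α, hαβ, _, .refl, .XiBot ha hc (inst c _ h2)⟩

end Function

/-! ### The construction in terms of levels -/

mutual

theorem Step.pred (hD : ∀ b, Nonempty (D b)) {α : Ordinal.{0}} {t t' : Tm S.C} :
    Step S α t t' → PRed S (lev S α) t t'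
  | .beta _ t s => .beta (.refl t) (.refl s)
  | .eta _ t => .eta (.refl t)
  | .crule hγ h1 hc hρ hs =>
    .can h1 hc hρ (levLt_le_lev _ _ ⟨_, hγ, _, .refl, Succ.value hD hs⟩)
  | .appL s h => .app (Step.pred hD h) (.refl s)
  | .appR t h => .app (.refl t) (Step.pred hD h)
  | .lam h => .lam (Step.pred hD h)

theorem Steps.preds (hD : ∀ b, Nonempty (D b)) {α : Ordinal.{0}} {t t' : Tm S.C} :
    Steps S α t t' → PReds S (lev S α) t t'
  | .refl _ _ => .refl
  | .tail h h' => .tail (Steps.preds hD h) (Step.pred hD h')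

theorem Lead.reach (hD : ∀ b, Nonempty (D b)) {α : Ordinal.{0}} {t ρ : Tm S.C} :
    Lead S α t ρ → Reach S (lev S α) t ρ
  | .mk h h' => ⟨_, Steps.preds hD h, Succ.value hD h'⟩

theorem LeadLt.levLt (hD : ∀ b, Nonempty (D b)) {α : Ordinal.{0}} {t ρ : Tm S.C} :
    LeadLt S α t ρ → levLt S α t ρ
  | .mk hγ h => ⟨_, hγ, Lead.reach hD h⟩

theorem Sim.isBody (hD : ∀ b, Nonempty (D b)) {α : Ordinal.{0}} {t : Tm S.C} {τ : ETy B} :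
    Sim S α t τ → IsTp τ ∧ IsBody S (ILM.levLt S α) τ 0 t.body
  | .ofA _ b => ⟨.inl (.base b), _, .refl, .var 0⟩
  | .ofH _ => ⟨.inl .o, _, _, .refl, .single (PRed.beta_lift _), .var 1⟩
  | .ofKom h => ⟨.inr (.inl rfl), by
      have := levLt_bind hD _ _ (fun n => .var (n + 1)) (LeadLt.levLt hD h)
      rwa [← Tm.lift_eq_bind] at this⟩
  | .ofKeps h => ⟨.inr (.inr rfl), by
      have := levLt_bind hD _ _ (fun n => .var (n + 1)) (LeadLt.levLt hD h)
      rwa [← Tm.lift_eq_bind] at this⟩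
  | .ofF h1 h2 s1 s2 =>
    IsBody.Ft hD (max_lt h1 h2) (Sim.isBody hD s1).1 (Sim.isBody hD s2).1
      ((Sim.isBody hD s1).2.mono (levLt_mono (le_max_left _ _)))
      ((Sim.isBody hD s2).2.mono (levLt_mono (le_max_right _ _)))
  | .ofFom hγ h => ⟨.inr (.inl rfl), levLt_Ft_eps hD hγ (Sim.isBody hD h).2⟩

theorem Succ.value (hD : ∀ b, Nonempty (D b)) {α : Ordinal.{0}} {t ρ : Tm S.C} :
    Succ S α t ρ → Value S (lev S α) t ρ
  | .refl hτ hρ _ => .refl ⟨_, hτ, hρ⟩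
  | .fn hρ h => .fn hρ fun a ha => levLt_le_lev _ _ (LeadLt.levLt hD (h a ha))
  | .topLA _ b => .L_of_body (.A _ _)
  | .topLH _ => .L_of_body (.L _)
  | .topA hc _ => .A hc
  | .topH hc _ => .H_of_rigid (.can (by rcases hc with rfl | rfl; exacts [S.top_mem, S.bot_mem]))
  | .xiTop _ h1 h2 => .XiTop ((Sim.isBody hD h1).2.ext_of_body.mono levLt_le_lev)
      fun c hc => levLt_le_lev _ _ (LeadLt.levLt hD (h2 c hc))
  | .xiHTop _ _ _ => .H_of_rigid (.Xi _ _)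
  | .flTopEps _ _ => .L_Ft _ _
  | .flTop _ _ _ _ => .L_Ft _ _
  | .hiTop _ h => by
      obtain ⟨γ, hγ, u, hu, hv⟩ := LeadLt.levLt hD h
      refine .L (.head (PRed.ext_body _) ?_) (hv.rigid S.top_mem).lift
      exact (hu.lift (lev_regular hD γ).bind).mono (lev_mono hγ.le)
  | .xiBot _ _ _ h1 h3 hb => .XiBot ((Sim.isBody hD h1).2.ext_of_body.mono levLt_le_lev) h3
      (levLt_le_lev _ _ (LeadLt.levLt hD hb))

end


/-- **Corollary 4.11.**  If `t ⇝_α ρ₁` and `t ⇝_α ρ₂` where `ρ₁, ρ₂` are canonical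
terms with the same canonical type, then `ρ₁ ≡ ρ₂`. -/
theorem leadsto_consistent {B : Type} [Finite B] {D : B → Type} (hD : ∀ b, Nonempty (D b))
    (S : CanSys B D) (α : Ordinal.{0}) (t : Tm S.C) (τ : ETy B) (hτ : τ ≠ .omega)
    (ρ1 ρ2 : Tm S.C) (hρ1 : ρ1 ∈ S.TT τ) (hρ2 : ρ2 ∈ S.TT τ)
    (h1 : Lead S α t ρ1) (h2 : Lead S α t ρ2) : ρ1 = ρ2 := by
  exact (h1.reach hD).unique (lev_regular hD α) (lev_regular hD α) (lev_compat hD α α) hτ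
    hρ1 hρ2 (h2.reach hD)

end ILM
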